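/- arXiv:2010.02410 — 6 statements merged into one kernel-verified Lean document; each statement's English description precedes it below -/
import Mathlib

section
/- Let q be a prime power and 𝔽_q the finite field with q elements. Let t, n, k, d_1, …, d_t be positive integers with 1 ≤ k ≤ n ≤ (t−1)/2, d_1 > d_2 > ⋯ > d_t ≥ 2, and suppose char(𝔽_q) does not divide d_i for 1 ≤ i ≤ t. Let A = (a_{ij}) ∈ 𝔽_q^{n×t} satisfy hypothesis (H), and let g_1, …, g_n ∈ 𝔽_q[X_1, …, X_k] be polynomials with deg(g_j) < d_t for all 1 ≤ j ≤ n (constant polynomials allowed). If q > (6 n d_1)^{(2t+2)/(t−2n)} (a real power), then there exists x = (x_1, …, x_t) ∈ 𝔽_q^t with ∑_{j=1}^t a_{ij} x_j^{d_j} = g_i(x_1, …, x_k) for every 1 ≤ i ≤ n. -/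
open Finset

/-- The monomial functions with exponents below `d` span all functions on a finite set on which
every `x j ^ d j` agrees with a polynomial of total degree less than `d j`. -/
theorem card_le_prod_of_pow_eq_eval {κ F : Type*} [Fintype κ] [Field F] [Finite F]
    (Z : Finset (κ → F)) (d : κ → ℕ) (P : κ → MvPolynomial κ F)
    (hP : ∀ j, (P j).totalDegree < d j)
    (hZ : ∀ x ∈ Z, ∀ j, x j ^ d j = MvPolynomial.eval x (P j)) :
    #Z ≤ ∏ j, d j := by
  classical
  set b : (∀ j, Fin (d j)) → (Z → F) := fun e x => ∏ j, x.1 j ^ (e j : ℕ) with hb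
  set W : Submodule F (Z → F) := Submodule.span F (Set.range b) with hW
  have mono : ∀ (N : ℕ) (m : κ →₀ ℕ), m.degree = N → (fun x : Z => ∏ j, x.1 j ^ m j) ∈ W := by
    intro N
    induction N using Nat.strong_induction_on with
    | _ N ih =>
    intro m hm
    by_cases h : ∀ j, m j < d j
    · exact Submodule.subset_span ⟨fun j => ⟨m j, h j⟩, rfl⟩
    · push Not at h
      obtain ⟨j, hj⟩ := h
      set m' : κ →₀ ℕ := m - Finsupp.single j (d j) with hm'
      have hmm : m = m' + Finsupp.single j (d j) := by
        rw [hm', tsub_add_cancel_of_le]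
        simpa using hj
      have hdeg : m'.degree + d j = N := by
        rw [← hm, hmm]; simp
      have : (fun x : Z => ∏ i, x.1 i ^ m i)
          = ∑ s ∈ (P j).support, (P j).coeff s • fun x : Z => ∏ i, x.1 i ^ (m' + s) i := by
        ext x
        have h1 : ∏ i, x.1 i ^ m i = (∏ i, x.1 i ^ m' i) * x.1 j ^ d j := by
          rw [hmm]
          simp only [Finsupp.add_apply, pow_add, Finset.prod_mul_distrib]
          congr 1
          rw [Finset.prod_eq_single j] <;> simp +contextual [eq_comm]
        rw [h1, hZ x.1 x.2 j, MvPolynomial.eval_eq', Finset.mul_sum, Finset.sum_apply]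
        refine Finset.sum_congr rfl fun s _ => ?_
        simp only [Pi.smul_apply, smul_eq_mul, Finsupp.add_apply, pow_add,
          Finset.prod_mul_distrib]
        ring
      rw [this]
      refine Submodule.sum_mem _ fun s hs => Submodule.smul_mem _ _ ?_
      have h2 := MvPolynomial.le_totalDegree hs
      have h3 : s.degree ≤ (P j).totalDegree := h2
      refine ih (m' + s).degree ?_ _ rfl
      have := hP j
      rw [map_add]
      omega
  have htop : W = ⊤ := by
    refine eq_top_iff.2 fun f _ => ?_
    have hf : (fun x : κ → F => if h : x ∈ Z then f ⟨x, h⟩ else 0) ∈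
        Submodule.map (MvPolynomial.evalₗ F κ) ⊤ := by
      cases nonempty_fintype F
      have := MvPolynomial.map_restrict_dom_evalₗ F κ
      exact Submodule.map_mono le_top (this ▸ Submodule.mem_top)
    obtain ⟨p, -, hp⟩ := hf
    have : f = ∑ s ∈ p.support, p.coeff s • fun x : Z => ∏ i, x.1 i ^ s i := by
      ext x
      have := congrFun hp x.1
      simp only [MvPolynomial.evalₗ_apply, x.2, dite_true] at this
      rw [← this, MvPolynomial.eval_eq', Finset.sum_apply]
      rfl
    rw [this]
    exact Submodule.sum_mem _ fun s _ => Submodule.smul_mem _ _ (mono _ s rfl)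
  have hfin := finrank_range_le_card (R := F) b
  rw [Set.finrank, ← hW, htop, finrank_top, Module.finrank_fintype_fun_eq_card] at hfin
  simpa using hfin

/-- Parseval identity for a sum of additive characters. -/
theorem sum_norm_sq_sum_addChar {V X : Type*} [AddCommGroup V] [Fintype V] [Fintype X]
    (χ : X → AddChar V ℂ) [DecidableEq (AddChar V ℂ)] :
    ∑ v, ‖∑ x, χ x v‖ ^ 2
      = (Fintype.card V : ℝ) * #{p : X × X | χ p.1 = χ p.2} := by
  have h : ∀ v, ((‖∑ x, χ x v‖ ^ 2 : ℝ) : ℂ) = ∑ p : X × X, (χ p.1 - χ p.2) v := by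
    intro v
    rw [Complex.ofReal_pow, ← Complex.mul_conj', map_sum, Finset.sum_mul_sum,
      Fintype.sum_prod_type]
    refine Finset.sum_congr rfl fun x _ => Finset.sum_congr rfl fun y _ => ?_
    rw [sub_eq_add_neg, AddChar.add_apply, AddChar.neg_apply, AddChar.map_neg_eq_conj]
  have : ((∑ v, ‖∑ x, χ x v‖ ^ 2 : ℝ) : ℂ)
      = (((Fintype.card V : ℝ) * #{p : X × X | χ p.1 = χ p.2} : ℝ) : ℂ) := by
    rw [Complex.ofReal_sum, Finset.sum_congr rfl fun v _ => h v, Finset.sum_comm]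
    simp only [AddChar.sum_eq_ite, sub_eq_zero, Finset.sum_ite, Finset.sum_const_zero,
      Finset.sum_const, add_zero, nsmul_eq_mul]
    push_cast
    ring
  exact_mod_cast this

theorem card_pow_eq_le {F : Type*} [Field F] [Fintype F] [DecidableEq F] {d : ℕ} (hd : 0 < d)
    (a : F) : #{x : F | x ^ d = a} ≤ d := by
  refine le_trans (Finset.card_le_card ?_)
    ((Multiset.toFinset_card_le _).trans (Polynomial.card_nthRoots d a))
  intro x hx
  simpa [Polynomial.mem_nthRoots hd] using hx

/-- Averaging over the orbit of `y` under `d`-th powers gives square-root cancellation. -/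
theorem norm_sum_addChar_mul_pow_le {F : Type*} [Field F] [Fintype F]
    {ψ : AddChar F ℂ} (hψ : ψ.IsPrimitive) {d : ℕ} (hd : 0 < d) {y : F} (hy : y ≠ 0) :
    ‖∑ x, ψ (y * x ^ d)‖ ≤ 2 * d * √(Fintype.card F) := by
  classical
  set q := Fintype.card F with hq
  set S : F → ℂ := fun y => ∑ x, ψ (y * x ^ d) with hS
  have hq2 : 2 ≤ q := Fintype.one_lt_card
  have hpar : ∑ z, ‖S z‖ ^ 2 ≤ (q : ℝ) * (d * q) := by
    have h := sum_norm_sq_sum_addChar (fun x : F => ψ.mulShift (x ^ d))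
    simp only [AddChar.mulShift_apply] at h
    have h' : ∑ z, ‖S z‖ ^ 2 = ∑ v, ‖∑ x, ψ (x ^ d * v)‖ ^ 2 := by
      simp only [hS, mul_comm]
    rw [h', h]
    gcongr
    norm_cast
    refine Finset.card_le_mul_card_image_of_maps_to (f := Prod.snd) (t := univ)
      (fun _ _ => mem_univ _) d fun b _ => ?_
    refine le_trans ?_ (card_pow_eq_le hd (b ^ d))
    refine Finset.card_le_card_of_injOn Prod.fst ?_ ?_
    · rintro ⟨x, y⟩ hxy
      simp only [coe_filter, mem_filter, mem_univ, true_and, Set.mem_ofPred_eq] at hxy ⊢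
      rw [← hxy.2]
      exact AddChar.to_mulShift_inj_of_isPrimitive hψ hxy.1
    · rintro ⟨x, y⟩ hxy ⟨x', y'⟩ hxy' h
      simp only [coe_filter, mem_filter, mem_univ, true_and, Set.mem_ofPred_eq] at hxy hxy' h
      simp [h, hxy.2, hxy'.2]
  have hinv : ∀ u : Fˣ, S (y * u ^ d) = S y := by
    intro u
    refine Fintype.sum_equiv (Units.mulLeft u) _ _ fun x => ?_
    simp [mul_pow, mul_assoc]
  have hunits : ∑ u : Fˣ, ‖S (y * (u : F) ^ d)‖ ^ 2 ≤ d * ∑ z, ‖S z‖ ^ 2 := by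
    rw [← Finset.sum_fiberwise_of_maps_to (g := fun u : Fˣ => y * (u : F) ^ d) (t := univ)
      (fun _ _ => mem_univ _), Finset.mul_sum]
    refine Finset.sum_le_sum fun z _ => ?_
    rw [Finset.sum_congr rfl (g := fun _ => ‖S z‖ ^ 2)
      (fun u hu => by rw [(mem_filter.1 hu).2]), Finset.sum_const, nsmul_eq_mul]
    gcongr
    refine le_trans (Finset.card_le_card_of_injOn (fun u : Fˣ => (u : F)) ?_
      (Units.val_injective.injOn)) (card_pow_eq_le hd (z / y))
    intro u hu
    simp only [coe_filter, mem_univ, true_and, Set.mem_ofPred_eq] at hu ⊢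
    rw [← hu]; field_simp
  have hcard : (Fintype.card Fˣ : ℝ) = q - 1 := by
    rw [Fintype.card_units, Nat.cast_sub (by omega)]; simp [hq]
  simp only [hinv, Finset.sum_const, card_univ, nsmul_eq_mul, hcard] at hunits
  have hq2' : (2 : ℝ) ≤ q := by exact_mod_cast hq2
  have hd' : (0 : ℝ) < d := by exact_mod_cast hd
  have key : ‖S y‖ ^ 2 ≤ 4 * d ^ 2 * q := by
    have h1 : ((q : ℝ) - 1) * ‖S y‖ ^ 2 ≤ d * (q * (d * q)) :=
      hunits.trans (by gcongr)
    have h2 : (q : ℝ) / 2 * ‖S y‖ ^ 2 ≤ ((q : ℝ) - 1) * ‖S y‖ ^ 2 := by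
      gcongr; linarith
    have h3 : (q : ℝ) * ‖S y‖ ^ 2 ≤ q * (4 * d ^ 2 * q) := by
      nlinarith [mul_pos hd' hd', mul_nonneg (mul_nonneg hd'.le hd'.le) (sq_nonneg (q : ℝ))]
    exact le_of_mul_le_mul_left h3 (by linarith)
  refine abs_le_of_sq_le_sq' ?_ (by positivity) |>.2
  rw [mul_pow, Real.sq_sqrt (by positivity)]
  linarith

section DiagonalSystem

variable {ι κ μ F : Type*} [Fintype ι] [Fintype κ] [Fintype μ] [Field F] [Fintype F]

/-- After fixing one point of the pair and the coordinates outside the index set `U`, the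
remaining coordinates satisfy a system to which `card_le_prod_of_pow_eq_eval` applies. -/
theorem card_pairs_le [DecidableEq κ] [DecidableEq F] (a : κ → ι → F) (d : κ → ℕ) (D : ℕ)
    (hdD : ∀ j, d j ≤ D) (hD : 0 < D) (g : ι → MvPolynomial κ F)
    (hg : ∀ i j, (g i).totalDegree < d j)
    (h : (κ → F) → ι → F)
    (hh : ∀ x i, h x i = ∑ j, a j i * x j ^ d j - MvPolynomial.eval x (g i))
    (U : Finset κ) (P : Finset ((κ → F) × (κ → F)))
    (hP : ∀ l ∈ U, ∃ c : ι → F, c ⬝ᵥ a l = 1 ∧ (∀ j ∈ U, j ≠ l → c ⬝ᵥ a j = 0) ∧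
      ∀ p ∈ P, c ⬝ᵥ h p.1 = c ⬝ᵥ h p.2) :
    #P ≤ D ^ Fintype.card κ *
      (Fintype.card F ^ Fintype.card κ * Fintype.card F ^ #{l | l ∉ U}) := by
  classical
  choose! c hc1 hc0 hcP using hP
  have hexp : ∀ (c : ι → F) x, c ⬝ᵥ h x
      = ∑ j, (c ⬝ᵥ a j) * x j ^ d j - ∑ i, c i * MvPolynomial.eval x (g i) := by
    intro c x
    simp only [dotProduct, hh, mul_sub, Finset.sum_sub_distrib, Finset.mul_sum, Finset.sum_mul]
    rw [Finset.sum_comm]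
    simp only [mul_assoc]
  have hcard : #(univ : Finset ((κ → F) × ({l // l ∉ U} → F)))
      = Fintype.card F ^ Fintype.card κ * Fintype.card F ^ #{l | l ∉ U} := by
    rw [card_univ, Fintype.card_prod, Fintype.card_fun, Fintype.card_fun, Fintype.card_subtype]
  rw [← hcard]
  refine Finset.card_le_mul_card_image_of_maps_to
    (f := fun p => (p.2, fun l : {l // l ∉ U} => p.1 l)) (fun _ _ => mem_univ _) _ ?_
  rintro ⟨y, z⟩ -
  set z' : κ → F := fun l => if hl : l ∉ U then z ⟨l, hl⟩ else 0 with hz'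
  set d' : κ → ℕ := fun l => if l ∈ U then d l else 1 with hd'
  set Q : κ → MvPolynomial κ F := fun l =>
    if l ∈ U then MvPolynomial.C (c l ⬝ᵥ h y
        - ∑ j, if j ∈ U then 0 else (c l ⬝ᵥ a j) * z' j ^ d j)
      + ∑ i, MvPolynomial.C (c l i) * g i
    else MvPolynomial.C (z' l) with hQ
  set B := {p ∈ P | (p.2, fun l : {l // l ∉ U} => p.1 l) = (y, z)} with hB
  have hBy : ∀ p ∈ B, p.2 = y := fun p hp => congrArg Prod.fst (mem_filter.1 hp).2
  have hinj : Set.InjOn Prod.fst (B : Set ((κ → F) × (κ → F))) := by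
    intro p hp p' hp' hpp
    exact Prod.ext hpp ((hBy p hp).trans (hBy p' hp').symm)
  rw [← Finset.card_image_of_injOn hinj]
  refine (card_le_prod_of_pow_eq_eval _ d' Q ?_ ?_).trans ?_
  · intro l
    by_cases hl : l ∈ U
    · simp only [hQ, hd', hl, if_true]
      have hpos : 0 < d l := by
        by_contra hcon
        obtain hi | hi := isEmpty_or_nonempty ι
        · have := hc1 l hl
          simp at this
        · exact hcon ((Nat.zero_le _).trans_lt (hg hi.some l))
      refine (MvPolynomial.totalDegree_add _ _).trans_lt (max_lt ?_ ?_)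
      · rwa [MvPolynomial.totalDegree_C]
      · refine (MvPolynomial.totalDegree_finsetSum _ _).trans_lt ?_
        refine (Finset.sup_lt_iff hpos).2 fun i _ => ?_
        refine (MvPolynomial.totalDegree_mul _ _).trans_lt ?_
        simpa using hg i l
    · simp [hQ, hd', hl]
  · intro x hx l
    obtain ⟨p, hp, rfl⟩ := mem_image.1 hx
    have hpz : ∀ j, j ∉ U → p.1 j = z' j := by
      intro j hj
      have := congrFun (congrArg Prod.snd (mem_filter.1 hp).2) ⟨j, hj⟩
      simpa [hz', hj] using this
    by_cases hl : l ∈ U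
    · simp only [hQ, hd', hl, if_true, map_add, map_sum, MvPolynomial.eval_C, map_mul]
      have h1 := hcP l hl p (mem_filter.1 hp).1
      rw [hBy p hp] at h1
      rw [← h1, hexp]
      have h2 : ∑ j, (c l ⬝ᵥ a j) * p.1 j ^ d j = p.1 l ^ d l
          + ∑ j, if j ∈ U then 0 else (c l ⬝ᵥ a j) * z' j ^ d j := by
        have h3 : p.1 l ^ d l = ∑ j, if j = l then p.1 j ^ d j else 0 := by simp
        rw [h3, ← Finset.sum_add_distrib]
        refine Finset.sum_congr rfl fun j _ => ?_
        by_cases hj : j ∈ U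
        · by_cases hjl : j = l
          · subst hjl; simp [hl, hc1 j hl]
          · simp [hj, hjl, hc0 l hl j hj hjl]
        · have hjl : j ≠ l := by rintro rfl; exact hj hl
          simp [hj, hjl, hpz j hj]
      rw [h2]; ring
    · simp [hQ, hd', hl, hpz l hl]
  · rw [← Finset.card_univ, ← Finset.prod_const]
    refine Finset.prod_le_prod' fun l _ => ?_
    simp only [hd']
    split_ifs
    · exact hdD l
    · exact hD

/-- Mean-value bound for the character sums of `h` over the frequencies orthogonal to the columns
indexed by `R`. -/
theorem sum_norm_addChar_le [DecidableEq κ] {ψ : AddChar F ℂ} (hψ : ψ.IsPrimitive)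
    (a : κ ⊕ μ → ι → F)
    (ha : ∀ U : Finset (κ ⊕ μ), #U = Fintype.card ι →
      Function.Bijective fun (c : ι → F) (j : U) => c ⬝ᵥ a j)
    (hκ : Fintype.card κ ≤ Fintype.card ι)
    (hι : Fintype.card ι ≤ Fintype.card κ + Fintype.card μ)
    (d : κ → ℕ) (D : ℕ) (hdD : ∀ j, d j ≤ D) (hD : 0 < D) (g : ι → MvPolynomial κ F)
    (hg : ∀ i j, (g i).totalDegree < d j)
    (h : (κ → F) → ι → F)
    (hh : ∀ x i, h x i = ∑ j, a (.inl j) i * x j ^ d j - MvPolynomial.eval x (g i))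
    (R : Finset μ) (W : Finset (ι → F)) (hW : ∀ v ∈ W, v ≠ 0 ∧ ∀ j ∈ R, v ⬝ᵥ a (.inr j) = 0) :
    √(Fintype.card F) ^ #R * ∑ v ∈ W, ‖∑ x, ψ (v ⬝ᵥ h x)‖
      ≤ √(Fintype.card F) ^ (2 * Fintype.card ι + Fintype.card κ) * D ^ Fintype.card κ := by
  classical
  set q := Fintype.card F with hq
  set n := Fintype.card ι with hn
  set k := Fintype.card κ with hk
  set R' : Finset (κ ⊕ μ) := R.map .inr with hR'
  have hR'c : #R' = #R := card_map _
  by_cases hr : n ≤ #R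
  · obtain ⟨U, hUR, hU⟩ := Finset.exists_subset_card_eq (hR'c ▸ hr : n ≤ #R')
    rw [Finset.sum_eq_zero, mul_zero]
    · positivity
    · intro v hvmem
      obtain ⟨hv, hvR⟩ := hW v hvmem
      refine absurd ((ha U hU).1 ?_) hv
      ext ⟨j, hj⟩
      obtain ⟨j', hj', rfl⟩ := mem_map.1 (hUR hj)
      simpa using hvR j' hj'
  push Not at hr
  obtain ⟨U, hRU, hU, hUκ⟩ : ∃ U : Finset (κ ⊕ μ), R' ⊆ U ∧ #U = n ∧
      #{l : κ | Sum.inl l ∉ U} ≤ #R := by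
    set K : Finset (κ ⊕ μ) := univ.map .inl with hK
    have hdisj : Disjoint R' K := by
      rw [Finset.disjoint_left]
      simp [hR', hK]
    have hRK : #(R' ∪ K) = #R + k := by
      rw [card_union_of_disjoint hdisj, hR'c, hK, card_map, card_univ]
    rcases le_total (#R + k) n with hle | hle
    · obtain ⟨U, hU1, -, hU2⟩ := Finset.exists_subsuperset_card_eq (subset_univ (R' ∪ K))
        (hRK ▸ hle) (by simpa [card_univ] using hι)
      refine ⟨U, subset_union_left.trans hU1, hU2, ?_⟩
      rw [Finset.filter_false_of_mem]
      · simp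
      · intro l _ hl
        exact hl (hU1 (mem_union_right _ (by simp [hK])))
    · obtain ⟨U, hU1, hU3, hU2⟩ := Finset.exists_subsuperset_card_eq
        (subset_union_left (s₁ := R') (s₂ := K)) (hR'c ▸ hr.le) (hRK ▸ hle)
      refine ⟨U, hU1, hU2, ?_⟩
      have h1 : #{l : κ | Sum.inl l ∉ U} ≤ #((R' ∪ K) \ U) := by
        refine Finset.card_le_card_of_injOn Sum.inl ?_ Sum.inl_injective.injOn
        intro l hl
        simp only [coe_filter, mem_univ, true_and, Set.mem_ofPred_eq] at hl
        simp [hK, hl]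
      rw [card_sdiff_of_subset hU3, hRK, hU2] at h1
      omega
  let V : Submodule F (ι → F) :=
    { carrier := {v | ∀ j ∈ R, v ⬝ᵥ a (.inr j) = 0}
      add_mem' := fun {v w} hv hw j hj => by rw [add_dotProduct, hv j hj, hw j hj, add_zero]
      zero_mem' := fun j _ => zero_dotProduct _
      smul_mem' := fun r v hv j hj => by rw [smul_dotProduct, hv j hj, smul_zero] }
  set χ : (κ → F) → AddChar V ℂ := fun x => ψ.compAddMonoidHom
    { toFun := fun v => v.1 ⬝ᵥ h x
      map_zero' := zero_dotProduct _
      map_add' := fun v w => add_dotProduct _ _ _ } with hχ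
  have hχv : ∀ x v, χ x v = ψ (v.1 ⬝ᵥ h x) := fun _ _ => rfl
  have hχeq : ∀ x y, χ x = χ y → ∀ v ∈ V, v ⬝ᵥ h x = v ⬝ᵥ h y := by
    intro x y hxy v hv
    refine AddChar.to_mulShift_inj_of_isPrimitive hψ (DFunLike.ext _ _ fun r => ?_)
    have := DFunLike.congr_fun hxy ⟨r • v, V.smul_mem r hv⟩
    simpa [hχv, smul_dotProduct, mul_comm] using this
  have hsum : ∑ v ∈ W, ‖∑ x, ψ (v ⬝ᵥ h x)‖
      ≤ ∑ v : V, ‖∑ x, χ x v‖ := by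
    have hsub : ∑ v : V, ‖∑ x, χ x v‖ = ∑ v with v ∈ V, ‖∑ x, ψ (v ⬝ᵥ h x)‖ :=
      (Finset.sum_subtype (univ.filter fun v => v ∈ V) (by simp)
        (fun v => ‖∑ x, ψ (v ⬝ᵥ h x)‖)).symm
    rw [hsub]
    refine Finset.sum_le_sum_of_subset_of_nonneg ?_ fun _ _ _ => norm_nonneg _
    intro v hv
    exact mem_filter.2 ⟨mem_univ _, (hW v hv).2⟩
  have hVcard : q ^ #R * Fintype.card V ≤ q ^ n := by
    have h1 : Fintype.card V ≤ q ^ #(U \ R') := by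
      have : Fintype.card (↥(U \ R') → F) = q ^ #(U \ R') := by
        rw [Fintype.card_fun, Fintype.card_coe]
      rw [← this]
      refine Fintype.card_le_of_injective
        (fun v j => v.1 ⬝ᵥ a j) fun v w hvw => Subtype.ext ((ha U hU).1 ?_)
      ext ⟨j, hj⟩
      by_cases hjR : j ∈ R'
      · obtain ⟨j', hj', rfl⟩ := mem_map.1 hjR
        exact (v.2 j' hj').trans (w.2 j' hj').symm
      · exact congrFun hvw ⟨j, mem_sdiff.2 ⟨hj, hjR⟩⟩
    have h2 : #R + #(U \ R') = n := by
      rw [card_sdiff_of_subset hRU, hU, hR'c]; omega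
    calc _ ≤ q ^ #R * q ^ #(U \ R') := by gcongr
      _ = q ^ n := by rw [← pow_add, h2]
  have hpairs : #{p : (κ → F) × (κ → F) | χ p.1 = χ p.2} ≤ D ^ k * (q ^ k * q ^ #R) := by
    refine (card_pairs_le (fun j => a (.inl j)) d D hdD hD g hg h hh
      (univ.filter fun l => Sum.inl l ∈ U) _ ?_).trans ?_
    · intro l hl
      have hlU : Sum.inl l ∈ U := by simpa using hl
      obtain ⟨v, hv⟩ := (ha U hU).2 (Pi.single ⟨_, hlU⟩ 1)
      have hv' : ∀ j (hj : j ∈ U), j ≠ .inl l → v ⬝ᵥ a j = 0 := by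
        intro j hj hjl
        have := congrFun hv ⟨j, hj⟩
        simpa [Pi.single_apply, hjl] using this
      refine ⟨v, by simpa using congrFun hv ⟨_, hlU⟩, fun j hj hjl => hv' _ (by simpa using hj)
        (by simpa using hjl), fun p hp => hχeq _ _ (by simpa using hp) v ?_⟩
      exact fun j hj => hv' _ (hRU (by simpa [hR'] using hj)) (by simp)
    · gcongr
      · exact Fintype.card_pos
      · simpa using hUκ
  have hCS := sq_sum_le_card_mul_sum_sq (s := univ) (f := fun v : V => ‖∑ x, χ x v‖)
  rw [sum_norm_sq_sum_addChar, card_univ] at hCS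
  set T := ∑ v : V, ‖∑ x, χ x v‖ with hT
  have hT0 : 0 ≤ T := Finset.sum_nonneg fun _ _ => norm_nonneg _
  refine (mul_le_mul_of_nonneg_left hsum (pow_nonneg (Real.sqrt_nonneg _) _)).trans ?_
  refine abs_le_of_sq_le_sq' ?_ (by positivity) |>.2
  have hs : √(q : ℝ) ^ 2 = q := Real.sq_sqrt (by positivity)
  have hpairs' : (#{p : (κ → F) × (κ → F) | χ p.1 = χ p.2} : ℝ) ≤ D ^ k * (q ^ k * q ^ #R) := by
    exact_mod_cast hpairs
  have hVcard' : (q : ℝ) ^ #R * Fintype.card V ≤ q ^ n := by exact_mod_cast hVcard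
  have hD1 : (1 : ℝ) ≤ D := by exact_mod_cast hD
  calc (√(q : ℝ) ^ #R * T) ^ 2 = (√(q : ℝ) ^ 2) ^ #R * T ^ 2 := by ring
    _ = (q : ℝ) ^ #R * T ^ 2 := by rw [hs]
    _ ≤ (q : ℝ) ^ #R * (Fintype.card V * (Fintype.card V * (D ^ k * (q ^ k * q ^ #R)))) := by
        gcongr
        exact hCS.trans (by gcongr)
    _ = ((q : ℝ) ^ #R * Fintype.card V) ^ 2 * (D ^ k * q ^ k) := by ring
    _ ≤ ((q : ℝ) ^ n) ^ 2 * ((D ^ k * D ^ k) * q ^ k) := by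
        gcongr
        exact le_mul_of_one_le_left (by positivity) (one_le_pow₀ hD1)
    _ = ((√(q : ℝ) ^ 2) ^ n) ^ 2 * ((D ^ k * D ^ k) * (√(q : ℝ) ^ 2) ^ k) := by rw [hs]
    _ = _ := by ring

theorem sum_addChar_dotProduct_eq_zero [DecidableEq ι] {ψ : AddChar F ℂ} (hψ : ψ.IsPrimitive)
    {w : ι → F} (hw : w ≠ 0) : ∑ v : ι → F, ψ (v ⬝ᵥ w) = 0 := by
  classical
  obtain ⟨i, hi⟩ := Function.ne_iff.1 hw
  set χ : AddChar (ι → F) ℂ := ψ.compAddMonoidHom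
    { toFun := fun v => v ⬝ᵥ w
      map_zero' := zero_dotProduct _
      map_add' := fun v w => add_dotProduct _ _ _ } with hχ
  have hχv : ∀ v, χ v = ψ (v ⬝ᵥ w) := fun _ => rfl
  simp only [← hχv]
  rw [AddChar.sum_eq_ite, if_neg]
  intro h0
  refine hψ hi (DFunLike.ext _ _ fun r => ?_)
  have := DFunLike.congr_fun h0 (Pi.single i r)
  simpa [hχv, mul_comm] using this

/-- Solvability of a diagonal system whose right-hand side depends on the `κ`-variables only. -/
theorem exists_eq_eval_of_lt [DecidableEq ι] (a : κ ⊕ μ → ι → F)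
    (ha : ∀ U : Finset (κ ⊕ μ), #U = Fintype.card ι →
      Function.Bijective fun (c : ι → F) (j : U) => c ⬝ᵥ a j)
    (hκ : Fintype.card κ ≤ Fintype.card ι)
    (hι : Fintype.card ι ≤ Fintype.card κ + Fintype.card μ)
    (d : κ → ℕ) (e : μ → ℕ) (D : ℕ) (hdD : ∀ j, d j ≤ D) (he : ∀ j, 0 < e j)
    (heD : ∀ j, e j ≤ D) (hD : 0 < D) (g : ι → MvPolynomial κ F)
    (hg : ∀ i j, (g i).totalDegree < d j)
    (hlt : √(Fintype.card F) ^ (2 * Fintype.card ι) *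
        (D ^ Fintype.card κ * (2 * D + 1) ^ Fintype.card μ)
      < √(Fintype.card F) ^ (Fintype.card κ + Fintype.card μ)) :
    ∃ (x : κ → F) (y : μ → F), ∀ i,
      ∑ j, a (.inl j) i * x j ^ d j + ∑ j, a (.inr j) i * y j ^ e j
        = MvPolynomial.eval x (g i) := by
  classical
  by_contra hcon
  push Not at hcon
  set ψ := AddChar.FiniteField.primitiveChar_to_Complex F
  have hψ : ψ.IsPrimitive := AddChar.FiniteField.primitiveChar_to_Complex_isPrimitive F
  set h : (κ → F) → ι → F :=
    fun x i => ∑ j, a (.inl j) i * x j ^ d j - MvPolynomial.eval x (g i) with hh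
  set T : (ι → F) → ℂ := fun v => ∑ x, ψ (v ⬝ᵥ h x) with hT
  set S : μ → F → ℂ := fun j b => ∑ y, ψ (b * y ^ e j) with hS
  set s := √(Fintype.card F : ℝ) with hs
  have hs2 : s ^ 2 = Fintype.card F := Real.sq_sqrt (by positivity)
  have hs0 : 0 < s := Real.sqrt_pos.2 (by exact_mod_cast Fintype.card_pos)
  have hψsum : ∀ f : μ → F, ψ (∑ j, f j) = ∏ j, ψ (f j) := fun f => by
    exact map_prod ψ.toMonoidHom (fun j => Multiplicative.ofAdd (f j)) univ
  have hzero : ∑ v : ι → F, T v * ∏ j, S j (v ⬝ᵥ a (.inr j)) = 0 := by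
    have h1 : ∀ v, T v * ∏ j, S j (v ⬝ᵥ a (.inr j))
        = ∑ x, ∑ y : μ → F, ψ (v ⬝ᵥ (h x + fun i => ∑ j, a (.inr j) i * y j ^ e j)) := by
      intro v
      rw [hT, hS, Finset.prod_univ_sum, Fintype.piFinset_univ, Finset.sum_mul_sum]
      refine Finset.sum_congr rfl fun x _ => Finset.sum_congr rfl fun y _ => ?_
      rw [dotProduct_add, AddChar.map_add_eq_mul, ← hψsum]
      congr 2
      simp only [dotProduct, Finset.mul_sum, Finset.sum_mul]
      rw [Finset.sum_comm]
      simp only [mul_assoc]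
    simp only [h1]
    rw [Finset.sum_comm]
    refine Finset.sum_eq_zero fun x _ => ?_
    rw [Finset.sum_comm]
    refine Finset.sum_eq_zero fun y _ => sum_addChar_dotProduct_eq_zero hψ fun h0 => ?_
    obtain ⟨i, hi⟩ := hcon x y
    refine hi ?_
    have := congrFun h0 i
    simp only [hh, Pi.add_apply, Pi.zero_apply] at this
    linear_combination this
  have hmain : T 0 * ∏ j, S j ((0 : ι → F) ⬝ᵥ a (.inr j))
      = (((Fintype.card F : ℝ) ^ (Fintype.card κ + Fintype.card μ) : ℝ) : ℂ) := by
    simp [hT, hS, pow_add]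
  have hSle : ∀ j b, ‖S j b‖ ≤ (if b = 0 then (Fintype.card F : ℝ) else 0) + 2 * D * s := by
    intro j b
    split_ifs with hb
    · refine le_add_of_le_of_nonneg ?_ (by positivity)
      simp [hS, hb]
    · rw [zero_add]
      refine (norm_sum_addChar_mul_pow_le hψ (he j) hb).trans ?_
      gcongr
      exact heD j
  have herr : ∑ v : ι → F with v ≠ 0, ‖T v‖ * ∏ j, ‖S j (v ⬝ᵥ a (.inr j))‖
      ≤ s ^ (2 * Fintype.card ι + Fintype.card κ) * D ^ Fintype.card κ *
        (s + 2 * D * s) ^ Fintype.card μ := by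
    calc _ ≤ ∑ v : ι → F with v ≠ 0, ‖T v‖ * ∏ j : μ,
          ((if v ⬝ᵥ a (.inr j) = 0 then (Fintype.card F : ℝ) else 0) + 2 * D * s) := by
          gcongr with v _ j
          exact hSle j _
      _ = ∑ R : Finset μ, (∑ v : ι → F with v ≠ 0 ∧ ∀ j ∈ R, v ⬝ᵥ a (.inr j) = 0, ‖T v‖) *
          ((Fintype.card F : ℝ) ^ #R * ∏ _j ∈ Rᶜ, 2 * D * s) := by
          simp only [Fintype.prod_add, Finset.mul_sum, Finset.sum_mul]
          rw [Finset.sum_comm]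
          refine Finset.sum_congr rfl fun R _ => ?_
          rw [← Finset.filter_filter, Finset.sum_filter (fun v => ∀ j ∈ R, v ⬝ᵥ a (.inr j) = 0)]
          refine Finset.sum_congr rfl fun v _ => ?_
          rw [Finset.prod_ite_zero]
          split_ifs <;> simp
      _ ≤ ∑ R : Finset μ, s ^ (2 * Fintype.card ι + Fintype.card κ) * D ^ Fintype.card κ *
          ((∏ _j ∈ R, s) * ∏ _j ∈ Rᶜ, 2 * D * s) := by
          refine Finset.sum_le_sum fun R _ => ?_
          have hR := sum_norm_addChar_le hψ a ha hκ hι d D hdD hD g hg h (fun _ _ => rfl) R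
            {v | v ≠ 0 ∧ ∀ j ∈ R, v ⬝ᵥ a (.inr j) = 0} (fun v hv => (mem_filter.1 hv).2)
          rw [← hs2, Finset.prod_const s, ← pow_mul, mul_comm 2 #R, pow_mul, sq]
          calc _ = (s ^ #R * ∑ v : ι → F with v ≠ 0 ∧ ∀ j ∈ R, v ⬝ᵥ a (.inr j) = 0, ‖T v‖) *
                (s ^ #R * ∏ _j ∈ Rᶜ, 2 * D * s) := by ring
            _ ≤ _ := by gcongr
      _ = _ := by
          rw [← Finset.mul_sum, ← Fintype.prod_add]
          simp
  rw [← Finset.add_sum_erase _ _ (mem_univ 0), hmain] at hzero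
  have hnorm : (Fintype.card F : ℝ) ^ (Fintype.card κ + Fintype.card μ)
      ≤ ∑ v : ι → F with v ≠ 0, ‖T v‖ * ∏ j, ‖S j (v ⬝ᵥ a (.inr j))‖ := by
    have h1 := congrArg norm (eq_neg_of_add_eq_zero_left hzero)
    rw [norm_neg, Complex.norm_real, Real.norm_of_nonneg (by positivity)] at h1
    rw [h1, Finset.filter_ne']
    refine (norm_sum_le _ _).trans_eq (Finset.sum_congr rfl fun v _ => ?_)
    rw [norm_mul, norm_prod]
  refine absurd (hnorm.trans herr) (not_le.2 ?_)
  calc _ = s ^ (2 * Fintype.card ι) * (D ^ Fintype.card κ * (2 * D + 1) ^ Fintype.card μ) *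
        s ^ (Fintype.card κ + Fintype.card μ) := by
        rw [show s + 2 * D * s = (2 * D + 1) * s by ring, mul_pow]; ring
    _ < s ^ (Fintype.card κ + Fintype.card μ) * s ^ (Fintype.card κ + Fintype.card μ) := by
        gcongr
    _ = _ := by rw [← hs2]; ring

end DiagonalSystem

/-- Invertibility of all maximal minors, phrased through the columns of the matrix. -/
theorem bijective_dotProduct_of_submatrix_det_ne_zero {n : ℕ} {τ F : Type*} [Field F]
    (A : Matrix (Fin n) τ F)
    (hA : ∀ φ : Fin n ↪ τ, (A.submatrix id φ).det ≠ 0) (U : Finset τ) (hU : #U = n) :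
    Function.Bijective fun (c : Fin n → F) (j : U) => c ⬝ᵥ A.col j := by
  let φ := U.equivFinOfCardEq hU
  set M := A.submatrix id (φ.symm.toEmbedding.trans (Function.Embedding.subtype _)) with hMdef
  have hM : IsUnit M := (Matrix.isUnit_iff_isUnit_det _).2 (hA _).isUnit
  have := (φ.symm.arrowCongr (Equiv.refl F)).bijective.comp
    ⟨Matrix.vecMul_injective_iff_isUnit.2 hM, Matrix.vecMul_surjective_iff_isUnit.2 hM⟩
  convert this using 1
  ext c j
  simp [hMdef, Matrix.vecMul, dotProduct]

/-- The size hypothesis in the form used by `exists_eq_eval_of_lt`. -/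
theorem sqrt_pow_mul_lt_of_rpow_lt {q n k m D : ℕ} (hn : 0 < n) (hnt : 2 * n + 1 ≤ k + m)
    (hD : 0 < D)
    (hq : ((6 * n * D : ℕ) : ℝ) ^ ((2 * ((k + m : ℕ) : ℝ) + 2) / (((k + m : ℕ) : ℝ) - 2 * n))
      < (q : ℝ)) :
    √(q : ℝ) ^ (2 * n) * (D ^ k * (2 * D + 1) ^ m) < √(q : ℝ) ^ (k + m) := by
  obtain ⟨e, he⟩ := Nat.exists_eq_add_of_le (Nat.le_of_succ_le hnt)
  have he0 : 0 < e := by omega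
  rw [he] at hq
  set x : ℝ := ((6 * n * D : ℕ) : ℝ) with hx
  have hDx : D ≤ 6 * n * D := Nat.le_mul_of_pos_left _ (by omega)
  have hDx' : 2 * D + 1 ≤ 6 * n * D := by nlinarith [Nat.mul_le_mul hn hD]
  have hx1 : 1 ≤ x := by
    rw [hx]; exact_mod_cast hD.trans_le hDx
  have hs2 : √(q : ℝ) ^ 2 = q := Real.sq_sqrt (by positivity)
  have hq0 : (0 : ℝ) < q := (Real.rpow_nonneg (by linarith) _).trans_lt hq
  have hs0 : 0 < √(q : ℝ) := Real.sqrt_pos.2 hq0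
  have he' : (e : ℝ) ≠ 0 := by exact_mod_cast he0.ne'
  have h1 : x ^ (2 * (2 * n + e) + 2) < (q : ℝ) ^ e := by
    refine lt_of_eq_of_lt ?_ (pow_lt_pow_left₀ hq (Real.rpow_nonneg (by linarith) _) he0.ne')
    rw [← Real.rpow_natCast, ← Real.rpow_natCast, ← Real.rpow_mul (by linarith)]
    congr 1
    push_cast
    rw [add_sub_cancel_left]
    field_simp
  have h2 : x ^ (2 * n + e + 1) < √(q : ℝ) ^ e := by
    refine lt_of_pow_lt_pow_left₀ 2 (by positivity) ?_
    calc _ = x ^ (2 * (2 * n + e) + 2) := by ring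
      _ < (q : ℝ) ^ e := h1
      _ = (√(q : ℝ) ^ 2) ^ e := by rw [hs2]
      _ = _ := by ring
  have h3 : (D : ℝ) ^ k * (2 * D + 1) ^ m ≤ x ^ (2 * n + e + 1) := by
    calc (D : ℝ) ^ k * (2 * D + 1) ^ m ≤ x ^ k * x ^ m := by
          gcongr
          · rw [hx]; exact_mod_cast hDx
          · rw [hx]; exact_mod_cast hDx'
      _ = x ^ (2 * n + e) := by rw [← pow_add, he]
      _ ≤ _ := pow_le_pow_right₀ hx1 (Nat.le_succ _)
  rw [he, pow_add]
  exact mul_lt_mul_of_pos_left (h3.trans_lt h2) (by positivity)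


/-- existence of a solution of a system of deformed diagonal
equations when q is large enough. -/
theorem deformed_diagonal_system_existence
    (q t n k : ℕ) (hq : IsPrimePow q)
    (F : Type*) [Field F] [Fintype F] (hFq : Fintype.card F = q)
    (ht : 0 < t) (hk : 0 < k) (hkn : k ≤ n) (hnt : 2 * n + 1 ≤ t) (hkt : k ≤ t)
    (d : Fin t → ℕ) (hd : StrictAnti d) (hd2 : ∀ i, 2 ≤ d i)
    (hchar : ∀ i, ¬ (ringChar F ∣ d i))
    (A : Matrix (Fin n) (Fin t) F)
    (hH : ∀ φ : Fin n ↪ Fin t, (A.submatrix id φ).det ≠ 0)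
    (g : Fin n → MvPolynomial (Fin k) F)
    (hgdeg : ∀ j, (g j).totalDegree < d ⟨t - 1, Nat.sub_lt ht Nat.one_pos⟩)
    (hqbig : ((6 * n * d ⟨0, ht⟩ : ℕ) : ℝ) ^ ((2 * (t : ℝ) + 2) / ((t : ℝ) - 2 * n))
        < (q : ℝ)) :
    ∃ x : Fin t → F,
      ∀ i, ∑ j, A i j * x j ^ d j
        = MvPolynomial.eval (fun l : Fin k => x (Fin.castLE hkt l)) (g i) := by
  obtain ⟨m, rfl⟩ := Nat.exists_eq_add_of_le hkt
  subst hFq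
  have hanti : ∀ j, d j ≤ d ⟨0, ht⟩ := fun j => hd.antitone (Nat.zero_le _)
  have hlast : ∀ i j, (g i).totalDegree < d j := fun i j =>
    (hgdeg i).trans_le (hd.antitone (Nat.le_sub_one_of_lt j.2))
  have hpos : ∀ j, 0 < d j := fun j => Nat.zero_lt_two.trans_le (hd2 j)
  obtain ⟨x, y, hxy⟩ := exists_eq_eval_of_lt
    (fun j => (A.submatrix id finSumFinEquiv).col j)
    (fun U hU => bijective_dotProduct_of_submatrix_det_ne_zero _
      (fun φ => hH (φ.trans finSumFinEquiv.toEmbedding)) U (by simpa using hU))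
    (by simpa using hkn) (by simp only [Fintype.card_fin]; omega)
    (fun j => d (Fin.castAdd m j)) (fun j => d (Fin.natAdd k j)) (d ⟨0, ht⟩)
    (fun _ => hanti _) (fun _ => hpos _) (fun _ => hanti _) (hpos _) g
    (fun i j => hlast i _)
    (by simpa only [Fintype.card_fin] using
      sqrt_pow_mul_lt_of_rpow_lt (hk.trans_le hkn) hnt (hpos _) hqbig)
  refine ⟨Fin.append x y, fun i => ?_⟩
  have hx : (fun l : Fin k => Fin.append x y (Fin.castLE hkt l)) = x :=
    funext fun l => Fin.append_left x y l
  rw [hx, ← hxy i, Fin.sum_univ_add]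
  simp
end

section
/- Let q be a prime power and 𝔽_q the finite field with q elements. Let t, n, k, d_1, …, d_t be positive integers with 1 ≤ k ≤ n ≤ t, d_1 > d_2 > ⋯ > d_t ≥ 2. Let 1 = i_1 < i_2 < ⋯ < i_n ≤ t be indices, let a_{jl} ∈ 𝔽_q for 1 ≤ j ≤ n and i_j ≤ l ≤ t with a_{j,i_j} ≠ 0, and let g_1, …, g_n ∈ 𝔽_q[X_1, …, X_k] with deg(g_j) < d_t for each j (constant polynomials allowed). Define f̂_j := ∑_{l=i_j}^{t} a_{jl} X_l^{d_l} − g_j ∈ 𝔽_q[X_1, …, X_t] for 1 ≤ j ≤ n. Then f̂_1, …, f̂_n form a regular sequence in the polynomial ring 𝔽_q[X_1, …, X_t]. -/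
namespace MonomialOrder

open MvPolynomial

variable {σ K : Type*} [Field K] (m : MonomialOrder σ)

/-- A linear endomorphism of the polynomial ring sending every monomial to a polynomial with that
monomial as leading monomial is bijective. -/
theorem bijective_of_degree_map_monomial (φ : MvPolynomial σ K →ₗ[K] MvPolynomial σ K)
    (h_ne : ∀ s, φ (monomial s 1) ≠ 0) (h_deg : ∀ s, m.degree (φ (monomial s 1)) = s) :
    Function.Bijective φ := by
  classical
  have h_coeff : ∀ s, coeff s (φ (monomial s 1)) ≠ 0 := fun s => by
    have := m.coeff_degree_ne_zero_iff.mpr (h_ne s)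
    rwa [h_deg] at this
  constructor
  · rw [← LinearMap.ker_eq_bot, LinearMap.ker_eq_bot']
    intro p hp
    by_contra hp0
    have hsum : φ p = ∑ s ∈ p.support, coeff s p • φ (monomial s 1) := by
      conv_lhs => rw [p.as_sum]
      rw [map_sum]
      refine Finset.sum_congr rfl fun s _ => ?_
      rw [← map_smul, smul_monomial, smul_eq_mul, mul_one]
    have htop : coeff (m.degree p) (φ p) =
        coeff (m.degree p) p * coeff (m.degree p) (φ (monomial (m.degree p) 1)) := by
      rw [hsum, coeff_sum, Finset.sum_eq_single (m.degree p)]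
      · rw [coeff_smul, smul_eq_mul]
      · intro s hs hne
        rw [coeff_smul, m.coeff_eq_zero_of_lt (f := φ (monomial s 1)), smul_zero]
        rw [h_deg]
        exact lt_of_le_of_ne (m.le_degree hs) fun h => hne (m.toSyn.injective h)
      · intro hs
        rw [notMem_support_iff.mp hs, zero_smul, coeff_zero]
    rw [hp, coeff_zero] at htop
    exact mul_ne_zero (m.coeff_degree_ne_zero_iff.mpr hp0) (h_coeff _) htop.symm
  · have h_mem : ∀ b : m.syn, monomial (m.toSyn.symm b) (1 : K) ∈ LinearMap.range φ := by
      intro b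
      induction b using WellFoundedLT.induction with
      | ind b ih =>
        set s := m.toSyn.symm b with hs
        have hsplit : monomial s (coeff s (φ (monomial s 1))) =
            φ (monomial s 1) - ∑ u ∈ (φ (monomial s 1)).support.erase s,
              coeff u (φ (monomial s 1)) • monomial u (1 : K) := by
          rw [eq_sub_iff_add_eq]
          conv_rhs => rw [(φ (monomial s 1)).as_sum]
          rw [← Finset.add_sum_erase _ _ (mem_support_iff.mpr (h_coeff s))]
          simp [smul_monomial]
        have hlead : monomial s (coeff s (φ (monomial s 1))) ∈ LinearMap.range φ := by
          rw [hsplit]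
          refine Submodule.sub_mem _ ⟨_, rfl⟩ (Submodule.sum_mem _ fun u hu => ?_)
          refine Submodule.smul_mem _ _ ?_
          obtain ⟨hus, hu⟩ := Finset.mem_erase.mp hu
          have hlt : m.toSyn u < b := by
            have hle := m.le_degree hu
            rw [h_deg] at hle
            have hne : m.toSyn u ≠ m.toSyn s := fun h => hus (m.toSyn.injective h)
            simpa [hs] using lt_of_le_of_ne hle hne
          simpa using ih _ hlt
        have := Submodule.smul_mem _ (coeff s (φ (monomial s 1)))⁻¹ hlead
        rwa [smul_monomial, smul_eq_mul, inv_mul_cancel₀ (h_coeff s)] at this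
    intro p
    rw [← LinearMap.mem_range, p.as_sum]
    refine Submodule.sum_mem _ fun s _ => ?_
    have := Submodule.smul_mem _ (coeff s p) (h_mem (m.toSyn s))
    simpa [smul_monomial] using this

end MonomialOrder

namespace MvPolynomial

open RingTheory.Sequence

variable {σ : Type*}

theorem mem_span_X_pow_iff {R : Type*} [CommSemiring R] (e : σ → ℕ) (S : Set σ)
    (p : MvPolynomial σ R) :
    p ∈ Ideal.span ((fun l => X l ^ e l) '' S) ↔ ∀ s ∈ p.support, ∃ l ∈ S, e l ≤ s l := by
  have himage : (fun l => (X l ^ e l : MvPolynomial σ R)) '' S =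
      (fun s => monomial s 1) '' ((fun l => Finsupp.single l (e l)) '' S) := by
    rw [Set.image_image]
    simp only [X_pow_eq_monomial]
  rw [himage, mem_ideal_span_monomial_image]
  simp

/-- Positive powers of distinct variables form a regular sequence. -/
theorem isRegular_map_X_pow {R : Type*} [CommRing R] [Nontrivial R] (e : σ → ℕ)
    (he : ∀ l, e l ≠ 0) (L : List σ) (hL : L.Nodup) :
    IsRegular (MvPolynomial σ R) (L.map fun l => (X l ^ e l : MvPolynomial σ R)) := by
  have hspan : ∀ L' : List σ, Ideal.ofList (L'.map fun l => (X l ^ e l : MvPolynomial σ R)) =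
      Ideal.span ((fun l => X l ^ e l) '' {l | l ∈ L'}) := fun L' => by
    rw [Ideal.ofList]
    congr 1
    ext r
    simp
  refine ⟨⟨fun i hi => ?_⟩, fun h => ?_⟩
  · rw [isSMulRegular_quotient_iff_mem_of_smul_mem]
    intro p
    rw [← List.map_take, smul_eq_mul, Ideal.mul_top, hspan, mem_span_X_pow_iff,
      mem_span_X_pow_iff, List.getElem_map, smul_eq_mul]
    rw [List.length_map] at hi
    intro hp s hs
    have hmem : Finsupp.single L[i] (e L[i]) + s ∈ (X L[i] ^ e L[i] * p).support := by
      rw [mem_support_iff, X_pow_eq_monomial, coeff_monomial_mul, one_mul]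
      exact mem_support_iff.mp hs
    obtain ⟨l, hl, hle⟩ := hp _ hmem
    refine ⟨l, hl, ?_⟩
    have hne : L[i] ≠ l := by
      rintro rfl
      obtain ⟨j, hj, hji⟩ := List.mem_take_iff_getElem.mp hl
      have := (hL.getElem_inj_iff).mp hji
      omega
    simpa [Finsupp.single_eq_of_ne' hne] using hle
  · rw [smul_eq_mul, Ideal.mul_top, hspan, eq_comm, Ideal.eq_top_iff_one,
      mem_span_X_pow_iff] at h
    obtain ⟨l, -, hl⟩ := h 0 (by simp)
    exact he l (by simpa using hl)

end MvPolynomial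

namespace MonomialOrder

open MvPolynomial RingTheory.Sequence

variable {σ K : Type*} [Field K] [Fintype σ] (m : MonomialOrder σ)

/-- Polynomials whose leading monomials are positive powers of distinct variables form a regular
sequence. -/
theorem isRegular_map_of_degree_eq_single (e : σ → ℕ) (he : ∀ l, e l ≠ 0)
    (h : σ → MvPolynomial σ K) (h_deg : ∀ l, m.degree (h l) = Finsupp.single l (e l))
    (L : List σ) (hL : L.Nodup) :
    IsRegular (MvPolynomial σ K) (L.map h) := by
  classical
  have h_ne : ∀ l, h l ≠ 0 := fun l => m.ne_zero_of_degree_ne_zero <| by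
    rw [h_deg]
    exact Finsupp.single_ne_zero.mpr (he l)
  let rem : (σ →₀ ℕ) → (σ →₀ ℕ) := fun s => Finsupp.equivFunOnFinite.symm fun l => s l % e l
  let img : (σ →₀ ℕ) → MvPolynomial σ K := fun s => monomial (rem s) 1 * ∏ l, h l ^ (s l / e l)
  let φ : MvPolynomial σ K →ₗ[K] MvPolynomial σ K := (basisMonomials σ K).constr K img
  have hφ : ∀ s, φ (monomial s 1) = img s := fun s =>
    (basisMonomials σ K).constr_basis K img s
  have hprod_ne : ∀ s : σ →₀ ℕ, ∏ l, h l ^ (s l / e l) ≠ 0 := fun s =>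
    Finset.prod_ne_zero_iff.mpr fun l _ => pow_ne_zero _ (h_ne l)
  have hmon_ne : ∀ s, monomial (rem s) (1 : K) ≠ 0 := fun s => by simp
  have hbij : Function.Bijective φ := by
    refine m.bijective_of_degree_map_monomial φ (fun s => ?_) (fun s => ?_)
    · rw [hφ]
      exact mul_ne_zero (hmon_ne s) (hprod_ne s)
    · rw [hφ, m.degree_mul (hmon_ne s) (hprod_ne s), m.degree_monomial, if_neg one_ne_zero,
        m.degree_prod fun l _ => pow_ne_zero _ (h_ne l)]
      ext l
      simp only [m.degree_pow, h_deg, Finsupp.add_apply, Finsupp.finsetSum_apply,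
        Finsupp.smul_apply, smul_eq_mul, Finsupp.single_apply, mul_ite, mul_zero,
        Finset.sum_ite_eq', Finset.mem_univ, if_true]
      exact Nat.mod_add_div' (s l) (e l)
  have hmul : ∀ l p, φ (X l ^ e l * p) = h l * φ p := by
    intro l p
    suffices φ ∘ₗ LinearMap.mulLeft K (X l ^ e l) = LinearMap.mulLeft K (h l) ∘ₗ φ from
      LinearMap.congr_fun this p
    refine (basisMonomials σ K).ext fun s => ?_
    have hrem : rem (Finsupp.single l (e l) + s) = rem s := by
      ext l'
      rcases eq_or_ne l l' with rfl | hne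
      · simp [rem]
      · simp [rem, Finsupp.single_eq_of_ne' hne]
    have hdiv : ∏ l', h l' ^ ((Finsupp.single l (e l) + s) l' / e l') =
        h l * ∏ l', h l' ^ (s l' / e l') := by
      rw [← Finset.mul_prod_erase _ _ (Finset.mem_univ l),
        ← Finset.mul_prod_erase _ (fun l' => h l' ^ (s l' / e l')) (Finset.mem_univ l), ← mul_assoc]
      congr 1
      · rw [Finsupp.add_apply, Finsupp.single_eq_same,
          Nat.add_div_left _ (Nat.pos_of_ne_zero (he l)), pow_succ']
      · refine Finset.prod_congr rfl fun l' hl' => ?_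
        rw [Finsupp.add_apply, Finsupp.single_eq_of_ne (Finset.ne_of_mem_erase hl'), zero_add]
    rw [coe_basisMonomials, LinearMap.comp_apply, LinearMap.comp_apply, LinearMap.mulLeft_apply,
      LinearMap.mulLeft_apply, X_pow_eq_monomial, monomial_mul, one_mul, hφ, hφ]
    simp only [img, hrem, hdiv]
    ring
  refine (AddEquiv.isRegular_congr (e := (LinearEquiv.ofBijective φ hbij).toAddEquiv) ?_).mp
    (isRegular_map_X_pow e he L hL)
  rw [List.forall₂_map_left_iff, List.forall₂_map_right_iff, List.forall₂_same]
  exact fun l _ p => hmul l p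

end MonomialOrder

namespace MonomialOrder

open MvPolynomial

theorem degree_degLex_eq_single_of_totalDegree_lt {σ R : Type*} [CommRing R] [LinearOrder σ]
    [WellFoundedGT σ] {p : MvPolynomial σ R} {l : σ} {c : R} (hc : c ≠ 0) {N : ℕ}
    (hp : (p - C c * X l ^ N).totalDegree < N) :
    degLex.degree p = Finsupp.single l N := by
  classical
  have hlead : degLex.degree (C c * X l ^ N : MvPolynomial σ R) = Finsupp.single l N := by
    rw [C_mul_X_pow_eq_monomial, degree_monomial, if_neg hc]
  rw [← add_sub_cancel (C c * X l ^ N) p, degree_add_of_lt, hlead]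
  rw [hlead, degLex_lt_iff, Finsupp.DegLex.lt_iff]
  left
  simpa [degree_degLexDegree] using hp

theorem degree_degLex_diagonal_sub {σ R : Type*} [CommRing R] [LinearOrder σ] [Fintype σ]
    (d : σ → ℕ) (hd : StrictAnti d) (a : σ → R) (i : σ) (ha : a i ≠ 0)
    {g : MvPolynomial σ R} (hg : g.totalDegree < d i) :
    degLex.degree ((∑ l ∈ Finset.univ.filter (fun l => i ≤ l), C (a l) * X l ^ d l) - g) =
      Finsupp.single i (d i) := by
  refine degree_degLex_eq_single_of_totalDegree_lt ha ?_
  rw [← Finset.add_sum_erase _ _ (Finset.mem_filter.mpr ⟨Finset.mem_univ i, le_rfl⟩),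
    add_sub_assoc, add_sub_cancel_left]
  refine (totalDegree_sub _ _).trans_lt (max_lt ?_ hg)
  refine (totalDegree_finsetSum _ _).trans_lt ?_
  rw [Finset.sup_lt_iff (Nat.zero_lt_of_lt hg)]
  intro l hl
  simp only [Finset.mem_erase, Finset.mem_filter, Finset.mem_univ, true_and] at hl
  rw [C_mul_X_pow_eq_monomial]
  refine (totalDegree_monomial_le _ _).trans_lt ?_
  simpa using hd (lt_of_le_of_ne hl.2 (Ne.symm hl.1))

end MonomialOrder

/-- the polynomials f̂_j obtained after row reduction form a
regular sequence in 𝔽_q[X_1,…,X_t]. -/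
theorem diagonal_polynomials_regular_sequence
    (q t n k : ℕ) (hq : IsPrimePow q)
    (F : Type*) [Field F] [Fintype F] (hFq : Fintype.card F = q)
    (ht : 0 < t) (hn : 0 < n) (hk : 0 < k) (hkn : k ≤ n) (hnt : n ≤ t) (hkt : k ≤ t)
    (d : Fin t → ℕ) (hd : StrictAnti d) (hd2 : ∀ i, 2 ≤ d i)
    (idx : Fin n → Fin t) (hidx : StrictMono idx)
    (hidx0 : idx ⟨0, hn⟩ = ⟨0, ht⟩)
    (a : Fin n → Fin t → F) (ha : ∀ j, a j (idx j) ≠ 0)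
    (g : Fin n → MvPolynomial (Fin k) F)
    (hgdeg : ∀ j, (g j).totalDegree < d ⟨t - 1, Nat.sub_lt ht Nat.one_pos⟩)
    (f : Fin n → MvPolynomial (Fin t) F)
    (hf : ∀ j, f j =
      (∑ l ∈ Finset.univ.filter (fun l : Fin t => idx j ≤ l),
          MvPolynomial.C (a j l) * MvPolynomial.X l ^ d l)
        - MvPolynomial.rename (Fin.castLE hkt) (g j)) :
    RingTheory.Sequence.IsRegular (MvPolynomial (Fin t) F) (List.ofFn f) := by
  have he_inj := hidx.injective
  let e : Fin t → ℕ := Function.extend idx (fun j => d (idx j)) 1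
  let h : Fin t → MvPolynomial (Fin t) F := Function.extend idx f MvPolynomial.X
  have hlist : List.ofFn f = (List.ofFn idx).map h := by
    rw [List.map_ofFn]
    congr 1
    exact (Function.extend_comp he_inj f MvPolynomial.X).symm
  rw [hlist]
  refine MonomialOrder.isRegular_map_of_degree_eq_single MonomialOrder.degLex e (fun l => ?_) h
    (fun l => ?_) _ (List.nodup_ofFn.mpr he_inj)
  · by_cases hl : ∃ j, idx j = l
    · obtain ⟨j, rfl⟩ := hl
      have := hd2 (idx j)
      simp only [e, he_inj.extend_apply]
      omega
    · simp [e, Function.extend_apply' _ _ _ hl]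
  · by_cases hl : ∃ j, idx j = l
    · obtain ⟨j, rfl⟩ := hl
      simp only [e, h, he_inj.extend_apply, hf]
      have hlast : ∀ l, d ⟨t - 1, Nat.sub_lt ht Nat.one_pos⟩ ≤ d l := fun l =>
        hd.antitone (Fin.mk_le_mk.mpr (by omega) : l ≤ ⟨t - 1, _⟩)
      exact MonomialOrder.degree_degLex_diagonal_sub d hd (a j) (idx j) (ha j)
        ((MvPolynomial.totalDegree_rename_le _ _).trans_lt ((hgdeg j).trans_le (hlast _)))
    · simp only [e, h, Function.extend_apply' _ _ _ hl, Pi.one_apply]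
      exact MonomialOrder.degree_X
end

section
/- Let q be a prime power and 𝔽_q the finite field with q elements. Let t, n, k, d_1, …, d_t be positive integers with 1 ≤ k ≤ n ≤ t − 1, d_1 > d_2 > ⋯ > d_t ≥ 2. Let A = (a_{ij}) ∈ 𝔽_q^{n×t} be a matrix of rank n, and let g_1, …, g_n ∈ 𝔽_q[X_1, …, X_k] with deg(g_j) < d_t for each j (constant polynomials allowed). Define f_i := ∑_{j=1}^t a_{ij} X_j^{d_j} − g_i ∈ 𝔽_q[X_1, …, X_t] for 1 ≤ i ≤ n, and let I := (f_1, …, f_n) be the ideal they generate. Then every minimal prime ideal over I has height exactly n; in particular, the quotient ring 𝔽_q[X_1, …, X_t]/I has Krull dimension t − n (i.e., the affine variety V(f_1, …, f_n) ⊂ 𝔸^t is equidimensional of dimension t − n). -/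
namespace MvPolynomial

theorem isPrime_span_X_image {σ R : Type*} [CommRing R] [IsDomain R] (s : Set σ) :
    (Ideal.span (X '' s : Set (MvPolynomial σ R))).IsPrime := by
  classical
  let φ : MvPolynomial σ R →ₐ[R] MvPolynomial σ R := aeval fun i ↦ if i ∈ s then 0 else X i
  have hφ : (Ideal.Quotient.mkₐ R (Ideal.span (X '' s : Set (MvPolynomial σ R)))).comp φ =
      Ideal.Quotient.mkₐ R _ := by
    ext i
    by_cases hi : i ∈ s
    · have : Ideal.Quotient.mk (Ideal.span (X '' s : Set (MvPolynomial σ R))) (X i) = 0 :=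
        Ideal.Quotient.eq_zero_iff_mem.2 (Ideal.subset_span ⟨i, hi, rfl⟩)
      simp [φ, hi, this]
    · simp [φ, hi]
  have hker : Ideal.span (X '' s : Set (MvPolynomial σ R)) = RingHom.ker φ := by
    refine le_antisymm (Ideal.span_le.2 ?_) fun p hp ↦ ?_
    · rintro _ ⟨i, hi, rfl⟩
      simp [φ, hi]
    · have := DFunLike.congr_fun hφ p
      rw [RingHom.mem_ker] at hp
      exact Ideal.Quotient.eq_zero_iff_mem.1 (by simpa [hp] using this.symm)
  rw [hker]
  exact RingHom.ker_isPrime _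

theorem card_le_height_span_X_image {σ R : Type*} [CommRing R] [IsDomain R] (s : Finset σ) :
    (s.card : ℕ∞) ≤ (Ideal.span (X '' (s : Set σ) : Set (MvPolynomial σ R))).height := by
  classical
  induction s using Finset.induction_on with
  | empty => simp
  | insert a s ha ih =>
    have := isPrime_span_X_image (R := R) (s : Set σ)
    have := isPrime_span_X_image (R := R) ((insert a s : Finset σ) : Set σ)
    rw [Finset.card_insert_of_notMem ha]
    push_cast
    refine (add_le_add_left ih 1).trans ?_
    rw [← Finset.coe_insert]
    refine Ideal.height_add_one_le_of_lt_of_isPrime (lt_of_le_of_ne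
      (Ideal.span_mono (Set.image_mono (by simp))) fun h ↦ ?_)
    have hX : (X a : MvPolynomial σ R) ∈ Ideal.span (X '' (s : Set σ)) := by
      rw [h]
      exact Ideal.subset_span ⟨a, by simp, rfl⟩
    obtain ⟨i, hi, hne⟩ := mem_ideal_span_X_image.1 hX (Finsupp.single a 1) (by simp [X])
    rw [Finsupp.single_apply_ne_zero] at hne
    exact ha (hne.1 ▸ hi)

/-- If each variable has a power which agrees with an element of the subalgebra `B` up to terms of
lower total degree, then the polynomial ring is finite over `B`. -/
theorem finite_of_totalDegree_X_pow_sub_lt {σ R : Type*} [Finite σ] [CommRing R]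
    (B : Subalgebra R (MvPolynomial σ R)) (D : σ → ℕ)
    (h : ∀ j, ∃ b ∈ B, (X j ^ D j - b).totalDegree < D j) :
    Module.Finite B (MvPolynomial σ R) := by
  classical
  have hfin : {e : σ →₀ ℕ | ∀ j, e j < D j}.Finite :=
    (Set.finite_Iic (Finsupp.equivFunOnFinite.symm D)).subset fun e he j ↦ (he j).le
  let M : Submodule B (MvPolynomial σ R) :=
    Submodule.span B ((fun e ↦ monomial e (1 : R)) '' {e | ∀ j, e j < D j})
  suffices H : ∀ m, ∀ p : MvPolynomial σ R, p.totalDegree < m → p ∈ M from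
    ⟨⟨(hfin.image fun e ↦ monomial e (1 : R)).toFinset, by
      rw [Set.Finite.coe_toFinset, eq_top_iff]
      exact fun p _ ↦ H _ p (Nat.lt_succ_self _)⟩⟩
  have hsmul : ∀ b ∈ B, ∀ x ∈ M, b * x ∈ M := fun b hb x hx ↦ M.smul_mem (⟨b, hb⟩ : B) hx
  intro m
  induction m with
  | zero => simp
  | succ m ih =>
    intro p hp
    rw [p.as_sum]
    refine sum_mem fun e he ↦ ?_
    have hem : e.degree ≤ m := by
      have : e.degree ≤ p.totalDegree := le_totalDegree he
      omega
    rw [← mul_one (coeff e p), ← C_mul_monomial]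
    refine hsmul _ (B.algebraMap_mem _) _ ?_
    by_cases hred : ∀ j, e j < D j
    · exact Submodule.subset_span ⟨e, hred, rfl⟩
    push Not at hred
    obtain ⟨j, hj⟩ := hred
    obtain ⟨b, hb, hlt⟩ := h j
    obtain ⟨e', rfl⟩ := exists_add_of_le (show Finsupp.single j (D j) ≤ e by simpa using hj)
    rw [map_add, Finsupp.degree_single] at hem
    have he' : (monomial e' (1 : R)).totalDegree ≤ e'.degree := totalDegree_monomial_le _ _
    have hmon : monomial (Finsupp.single j (D j) + e') (1 : R) =
        b * monomial e' 1 + (X j ^ D j - b) * monomial e' 1 := by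
      rw [← add_mul, add_sub_cancel, X_pow_eq_monomial, monomial_mul, one_mul]
    rw [hmon]
    refine M.add_mem (hsmul b hb _ (ih _ (by omega))) (ih _ ?_)
    have := totalDegree_mul (X j ^ D j - b) (monomial e' (1 : R))
    omega

end MvPolynomial

/-- A ring in which every prime over `I` has height at least `n` satisfies
`dim (R ⧸ I) + n ≤ dim R`. -/
theorem ringKrullDim_quotient_add_le_of_forall_le_height {R : Type*} [CommRing R] {I : Ideal R}
    {n : ℕ} (h : ∀ P : Ideal R, P.IsPrime → I ≤ P → (n : ℕ∞) ≤ P.height) :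
    ringKrullDim (R ⧸ I) + n ≤ ringKrullDim R := by
  rcases eq_or_ne I ⊤ with rfl | hI
  · rw [ringKrullDim_eq_bot_of_subsingleton]
    simp
  have : Nonempty (PrimeSpectrum.zeroLocus (R := R) I) := by
    rwa [Set.nonempty_coe_sort, Set.nonempty_iff_ne_empty, ne_eq,
      PrimeSpectrum.zeroLocus_empty_iff_eq_top]
  have : Nontrivial R := (Submodule.nontrivial_iff R).1 (nontrivial_of_ne I ⊤ hI)
  rw [ringKrullDim_quotient, Order.krullDim_eq_iSup_length, ringKrullDim,
    Order.krullDim_eq_iSup_length, ← WithBot.coe_natCast, ← WithBot.coe_add,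
    ENat.iSup_add, WithBot.coe_le_coe, iSup_le_iff]
  intro l
  have hl := h l.head.1.asIdeal l.head.1.2 l.head.2
  rw [PrimeSpectrum.height_eq_orderHeight] at hl
  obtain ⟨L, hL, hlen⟩ := Order.exists_series_of_le_height _ hl
  refine le_trans ?_ (le_iSup _ (L.smash (l.map Subtype.val fun _ _ ↦ id) hL))
  simp [hlen, add_comm, LTSeries.map]

open MvPolynomial in
/-- An integral extension of a polynomial ring satisfies the unmixedness theorem for ideals
generated by a subset of the variables. -/
theorem unmixed_of_isIntegral {ι F R : Type*} [Finite ι] [Field F] [CommRing R] [IsDomain R]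
    [IsNoetherianRing R] [Algebra (MvPolynomial ι F) R] [FaithfulSMul (MvPolynomial ι F) R]
    [Algebra.IsIntegral (MvPolynomial ι F) R] (hdim : ringKrullDim R ≤ Nat.card ι) (s : Finset ι)
    {I : Ideal R} (hI : I = Ideal.span ((fun i ↦ algebraMap (MvPolynomial ι F) R (X i)) '' s)) :
    (∀ P ∈ I.minimalPrimes, P.height = s.card) ∧
      ringKrullDim (R ⧸ I) = (Nat.card ι - s.card : ℕ) := by
  classical
  have : Fintype ι := Fintype.ofFinite ι
  have hcard : s.card ≤ Nat.card ι := Nat.card_eq_fintype_card (α := ι) ▸ s.card_le_univ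
  have hlow (s : Finset ι) (P : Ideal R) (hP : P.IsPrime)
      (h : ∀ i ∈ s, algebraMap (MvPolynomial ι F) R (X i) ∈ P) : (s.card : ℕ∞) ≤ P.height := by
    rw [Ideal.height_eq_height_add_of_liesOver_of_hasGoingDown (P.under (MvPolynomial ι F)) P]
    refine le_add_right ((card_le_height_span_X_image s).trans (Ideal.height_mono ?_))
    rw [Ideal.span_le]
    rintro _ ⟨i, hi, rfl⟩
    exact h i hi
  have hmem (P : Ideal R) (hP : I ≤ P) (i : ι) (hi : i ∈ s) :
      algebraMap (MvPolynomial ι F) R (X i) ∈ P :=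
    hP (hI ▸ Ideal.subset_span ⟨i, hi, rfl⟩)
  have hI' : I = Ideal.span
      (s.image fun i ↦ algebraMap (MvPolynomial ι F) R (X i) : Finset R) := by simp [hI]
  refine ⟨fun P hP ↦ le_antisymm ?_ (hlow s P hP.1.1 (hmem P hP.1.2)), le_antisymm ?_ ?_⟩
  · rw [hI'] at hP
    exact (Ideal.height_le_card_of_mem_minimalPrimes_span_finset hP).trans
      (mod_cast Finset.card_image_le)
  · have h1 := (ringKrullDim_quotient_add_le_of_forall_le_height
      fun P hP hle ↦ hlow s P hP (hmem P hle)).trans hdim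
    have h2 : Nat.card ι = (Nat.card ι - s.card) + s.card :=
      (Nat.sub_add_cancel hcard).symm
    rw [h2] at h1
    rw [Nat.cast_add] at h1
    exact (ENat.WithBot.add_le_add_natCast_right_iff).1 h1
  · have := isPrime_span_X_image (R := F) (Set.univ : Set ι)
    obtain ⟨Q, -, hQ, hQe⟩ := Ideal.exists_ideal_over_prime_of_isIntegral
      (Ideal.span (X '' (Set.univ : Set ι) : Set (MvPolynomial ι F))) (⊥ : Ideal R)
      (by simp [← RingHom.ker_eq_comap_bot, (RingHom.injective_iff_ker_eq_bot _).1
        (FaithfulSMul.algebraMap_injective (MvPolynomial ι F) R)])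
    have hX (i : ι) : algebraMap (MvPolynomial ι F) R (X i) ∈ Q := by
      rw [← Ideal.mem_comap, hQe]
      exact Ideal.subset_span ⟨i, trivial, rfl⟩
    have hIQ : I ≤ Q := by
      rw [hI, Ideal.span_le]
      rintro _ ⟨i, -, rfl⟩
      exact hX i
    have h1 := hlow Finset.univ Q hQ fun i _ ↦ hX i
    have h2 := height_le_ringKrullDim_quotient_add_spanFinrank hIQ
    have h3 : I.spanFinrank ≤ s.card := by
      rw [hI']
      exact (Submodule.spanFinrank_span_le_ncard_of_finite (Finset.finite_toSet _)).trans
        (by simpa only [Set.ncard_coe_finset] using Finset.card_image_le)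
    refine (ENat.WithBot.add_le_add_natCast_right_iff (c := s.card)).1 ?_
    rw [← Nat.cast_add, Nat.sub_add_cancel hcard]
    refine le_trans ?_ (h2.trans (by gcongr))
    rw [Nat.card_eq_fintype_card]
    exact WithBot.coe_le_coe.2 h1

open MvPolynomial in
/-- If a polynomial ring in finitely many variables over a field is integral over the subalgebra
generated by a family `y` of at most as many elements, then ideals generated by members of `y` are
unmixed. -/
theorem MvPolynomial.unmixed_of_isIntegral_adjoin {σ ι F : Type*} [Finite σ] [Finite ι] [Field F]
    (y : ι → MvPolynomial σ F) (hcard : Nat.card ι ≤ Nat.card σ)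
    [Algebra.IsIntegral (Algebra.adjoin F (Set.range y)) (MvPolynomial σ F)] (s : Finset ι)
    {I : Ideal (MvPolynomial σ F)} (hI : I = Ideal.span (y '' s)) :
    (∀ P ∈ I.minimalPrimes, P.height = s.card) ∧
      ringKrullDim (MvPolynomial σ F ⧸ I) = (Nat.card σ - s.card : ℕ) := by
  have hy : IsTranscendenceBasis F y := by
    refine Algebra.IsAlgebraic.isTranscendenceBasis_of_lift_le_trdeg_of_finite F y ?_
    rw [trdeg_of_isDomain, ← Nat.cast_card (α := ι), ← Nat.cast_card (α := σ)]
    simpa using hcard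
  have hιs : Nat.card ι = Nat.card σ := by
    have := hy.lift_cardinalMk_eq_trdeg
    rw [trdeg_of_isDomain, ← Nat.cast_card (α := ι), ← Nat.cast_card (α := σ)] at this
    simpa using this
  let _ : Algebra (MvPolynomial ι F) (MvPolynomial σ F) := (aeval y).toRingHom.toAlgebra
  have : FaithfulSMul (MvPolynomial ι F) (MvPolynomial σ F) :=
    (faithfulSMul_iff_algebraMap_injective _ _).2 hy.1
  have : Algebra.IsIntegral (MvPolynomial ι F) (MvPolynomial σ F) := by
    have integral_of_eq (B : Subalgebra F (MvPolynomial σ F)) (hB : B = (aeval y).range)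
        [Algebra.IsIntegral B (MvPolynomial σ F)] : (aeval (R := F) y).toRingHom.IsIntegral := by
      subst hB
      exact RingHom.IsIntegral.trans (aeval y).rangeRestrict.toRingHom
        (algebraMap (aeval (R := F) y).range (MvPolynomial σ F))
        (RingHom.isIntegral_of_surjective _ (aeval y).rangeRestrict_surjective)
        (algebraMap_isIntegral_iff.2 inferInstance)
    exact ⟨integral_of_eq _ (Algebra.adjoin_range_eq_range_aeval F y)⟩
  rw [← hιs]
  refine unmixed_of_isIntegral (F := F) ?_ s (hI.trans ?_)
  · rw [MvPolynomial.ringKrullDim_of_isNoetherianRing, ringKrullDim_eq_zero_of_field, hιs]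
    simp
  · congr! with i
    exact (aeval_X y i).symm

/-- The columns carrying a leading coefficient of some vector in the row space of `A`. -/
def Matrix.pivots {m n R : Type*} [Fintype m] [LT n] [NonUnitalNonAssocSemiring R]
    (A : Matrix m n R) : Set n :=
  {j | ∃ w : m → R, (Matrix.vecMul w A) j ≠ 0 ∧ ∀ i < j, (Matrix.vecMul w A) i = 0}

/-- The rank of a matrix is at most its number of pivot columns. -/
theorem Matrix.rank_le_card_pivots {m n F : Type*} [Fintype m] [Fintype n] [LinearOrder n]
    [Field F] (A : Matrix m n F) : A.rank ≤ Nat.card A.pivots := by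
  classical
  let V := LinearMap.range A.vecMulLinear
  have hV : A.rank = Module.finrank F V := by
    rw [← Matrix.rank_transpose, Matrix.rank, Matrix.mulVecLin_transpose]
  let φ : V →ₗ[F] (A.pivots → F) := (LinearMap.funLeft F F Subtype.val).comp V.subtype
  have hφ : Function.Injective φ := by
    refine (injective_iff_map_eq_zero φ).2 ?_
    rintro ⟨_, w, rfl⟩ h
    by_contra hne
    have hex : (Finset.univ.filter fun j ↦ (Matrix.vecMul w A) j ≠ 0).Nonempty := by
      by_contra hcon
      rw [Finset.not_nonempty_iff_eq_empty, Finset.filter_eq_empty_iff] at hcon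
      exact hne (Subtype.ext (funext fun j ↦ by simpa using hcon (Finset.mem_univ j)))
    have hmin := Finset.min'_mem _ hex
    set j := Finset.min' _ hex with hj
    have hjp : j ∈ A.pivots := by
      refine ⟨w, (Finset.mem_filter.1 hmin).2, fun i hi ↦ ?_⟩
      by_contra hi0
      exact (Finset.min'_le _ i (by simpa using hi0)).not_gt hi
    exact (Finset.mem_filter.1 hmin).2 (congr_fun h ⟨j, hjp⟩)
  rw [hV]
  simpa using LinearMap.finrank_le_finrank_of_injective hφ

/-- the variety defined by a system of deformed diagonal equations
is equidimensional of dimension t − n: every minimal prime over the ideal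
I = (f_1,…,f_n) has height n, and the quotient ring has Krull dimension t − n. -/
theorem diagonal_system_equidimensional
    (q t n k : ℕ) (hq : IsPrimePow q)
    (F : Type*) [Field F] [Fintype F] (hFq : Fintype.card F = q)
    (ht : 0 < t) (hk : 0 < k) (hkn : k ≤ n) (hnt : n + 1 ≤ t) (hkt : k ≤ t)
    (d : Fin t → ℕ) (hd : StrictAnti d) (hd2 : ∀ i, 2 ≤ d i)
    (A : Matrix (Fin n) (Fin t) F) (hrank : A.rank = n)
    (g : Fin n → MvPolynomial (Fin k) F)
    (hgdeg : ∀ j, (g j).totalDegree < d ⟨t - 1, Nat.sub_lt ht Nat.one_pos⟩)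
    (f : Fin n → MvPolynomial (Fin t) F)
    (hf : ∀ i, f i =
      (∑ j, MvPolynomial.C (A i j) * MvPolynomial.X j ^ d j)
        - MvPolynomial.rename (Fin.castLE hkt) (g i))
    (I : Ideal (MvPolynomial (Fin t) F)) (hI : I = Ideal.span (Set.range f)) :
    (∀ P ∈ I.minimalPrimes,
        ∃ hP : P.IsPrime,
          Order.height (⟨P, hP⟩ : PrimeSpectrum (MvPolynomial (Fin t) F))
            = (n : ℕ∞))
      ∧ ringKrullDim (MvPolynomial (Fin t) F ⧸ I) = ((t - n : ℕ) : WithBot ℕ∞) := by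
  classical
  let y : Fin n ⊕ ↥(A.pivotsᶜ) → MvPolynomial (Fin t) F :=
    Sum.elim f fun j ↦ MvPolynomial.X j.1
  have hcard : Nat.card (Fin n ⊕ ↥(A.pivotsᶜ)) ≤ Nat.card (Fin t) := by
    have h1 := A.rank_le_card_pivots
    have h2 := Set.ncard_add_ncard_compl A.pivots
    rw [Nat.card_sum, Nat.card_fin, ← h2]
    change _ + A.pivotsᶜ.ncard ≤ _
    rw [Nat.card_coe_set_eq] at h1
    omega
  have hyf (i : Fin n) : f i ∈ Algebra.adjoin F (Set.range y) :=
    Algebra.subset_adjoin ⟨Sum.inl i, rfl⟩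
  have hdlast (j : Fin t) : d ⟨t - 1, Nat.sub_lt ht Nat.one_pos⟩ ≤ d j :=
    hd.antitone (Fin.le_def.2 (Nat.le_sub_one_of_lt j.2))
  have hfin : Module.Finite (Algebra.adjoin F (Set.range y)) (MvPolynomial (Fin t) F) := by
    refine MvPolynomial.finite_of_totalDegree_X_pow_sub_lt _
      (fun j ↦ if j ∈ A.pivots then d j else 1) fun j ↦ ?_
    by_cases hj : j ∈ A.pivots
    · obtain ⟨w, hw, hlt⟩ := id hj
      simp only [hj, if_true]
      have hdj : 0 < d j := two_pos.trans_le (hd2 j)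
      set c := (Matrix.vecMul w A) j with hc
      refine ⟨∑ i, MvPolynomial.C (c⁻¹ * w i) * f i, sum_mem fun i _ ↦
        mul_mem (Subalgebra.algebraMap_mem _ _) (hyf i), ?_⟩
      have key : MvPolynomial.X j ^ d j - ∑ i, MvPolynomial.C (c⁻¹ * w i) * f i =
          ∑ i, MvPolynomial.C (c⁻¹ * w i) * MvPolynomial.rename (Fin.castLE hkt) (g i) -
          ∑ l ∈ Finset.univ.erase j,
            MvPolynomial.C (c⁻¹ * (Matrix.vecMul w A) l) * MvPolynomial.X l ^ d l := by
        have hsum : ∑ i, MvPolynomial.C (c⁻¹ * w i) *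
            ∑ l, MvPolynomial.C (A i l) * MvPolynomial.X l ^ d l =
            ∑ l, MvPolynomial.C (c⁻¹ * (Matrix.vecMul w A) l) * MvPolynomial.X l ^ d l := by
          simp_rw [Finset.mul_sum]
          rw [Finset.sum_comm]
          refine Finset.sum_congr rfl fun l _ ↦ ?_
          simp_rw [← mul_assoc, ← map_mul, ← Finset.sum_mul, ← map_sum, Matrix.vecMul,
            dotProduct, Finset.mul_sum, mul_assoc]
        simp_rw [hf, mul_sub, Finset.sum_sub_distrib]
        rw [hsum, ← Finset.add_sum_erase _ _ (Finset.mem_univ j), ← hc, inv_mul_cancel₀ hw,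
          MvPolynomial.C_1]
        ring
      rw [key]
      refine (MvPolynomial.totalDegree_sub _ _).trans_lt (max_lt ?_ ?_)
      · refine (MvPolynomial.totalDegree_finsetSum_le (d := d j - 1) fun i _ ↦ ?_).trans_lt
          (by omega)
        have h1 := MvPolynomial.totalDegree_mul (MvPolynomial.C (c⁻¹ * w i))
          (MvPolynomial.rename (Fin.castLE hkt) (g i))
        have h2 := MvPolynomial.totalDegree_rename_le (Fin.castLE hkt) (g i)
        have h3 := hgdeg i
        have h4 := hdlast j
        rw [MvPolynomial.totalDegree_C] at h1
        omega
      · refine (MvPolynomial.totalDegree_finsetSum_le (d := d j - 1) fun l hl ↦ ?_).trans_lt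
          (by omega)
        rcases (Finset.ne_of_mem_erase hl).lt_or_gt with h | h
        · simp [hlt l h]
        · have h1 := MvPolynomial.totalDegree_mul (MvPolynomial.C (c⁻¹ * (Matrix.vecMul w A) l))
            (MvPolynomial.X l ^ d l : MvPolynomial (Fin t) F)
          have h2 := hd h
          rw [MvPolynomial.totalDegree_C, MvPolynomial.totalDegree_X_pow] at h1
          omega
    · exact ⟨MvPolynomial.X j, Algebra.subset_adjoin ⟨Sum.inr ⟨j, hj⟩, rfl⟩, by simp [hj]⟩
  have hI' : I = Ideal.span
      (y '' (Finset.univ.image Sum.inl : Finset (Fin n ⊕ ↥(A.pivotsᶜ)))) := by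
    rw [hI, Finset.coe_image, Finset.coe_univ, Set.image_univ, ← Set.range_comp]
    rfl
  have hs : (Finset.univ.image Sum.inl : Finset (Fin n ⊕ ↥(A.pivotsᶜ))).card = n := by
    rw [Finset.card_image_of_injective _ Sum.inl_injective, Finset.card_fin]
  have := MvPolynomial.unmixed_of_isIntegral_adjoin y hcard _ hI'
  rw [hs, Nat.card_fin] at this
  exact ⟨fun P hP ↦ ⟨hP.1.1, by rw [← PrimeSpectrum.height_eq_orderHeight]; exact this.1 P hP⟩,
    this.2⟩
end

section
/- Let q be a prime power and 𝔽_q the finite field with q elements. Let t, n, k, d_1, …, d_t be positive integers with 1 ≤ k ≤ n, d_1 > d_2 > ⋯ > d_t ≥ 2, and suppose char(𝔽_q) does not divide d_i for 1 ≤ i ≤ t. Let A = (a_{ij}) ∈ 𝔽_q^{n×t} satisfy hypothesis (H), and let g_1, …, g_n ∈ 𝔽_q[X_1, …, X_k]. Assume either (a) every g_j is a constant and n ≤ t − 2, or (b) deg(g_j) < d_t for all j, deg(g_i) > 0 for at least one index i, and n ≤ (t−1)/2. Define f_i := ∑_{j=1}^t a_{ij} X_j^{d_j} − g_i ∈ 𝔽_q[X_1,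 …, X_t] for 1 ≤ i ≤ n. Then the ideal (f_1, …, f_n) of 𝔽_q[X_1, …, X_t] is a radical ideal. -/
open MvPolynomial

section Kummer

variable {ι R : Type*} [Fintype ι] [CommRing R]

/-- The ideal of `R[Y_i]` generated by the binomials `Y_i ^ e_i - h_i`. -/
noncomputable def kummerIdeal (e : ι → ℕ) (h : ι → R) : Ideal (MvPolynomial ι R) :=
  Ideal.span (Set.range fun i => X i ^ e i - C (h i))

/-- The `R`-linear reduction modulo `kummerIdeal e h`, which sends a monomial `Y ^ β` to
`∏ h_i ^ (β_i / e_i) * Y ^ (β % e)`. -/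
noncomputable def kummerNormalForm (e : ι → ℕ) (h : ι → R) :
    MvPolynomial ι R →ₗ[R] MvPolynomial ι R :=
  (basisMonomials ι R).constr R fun β =>
    monomial (Finsupp.equivFunOnFinite.symm fun i => β i % e i) (∏ i, h i ^ (β i / e i))

lemma kummerNormalForm_monomial (e : ι → ℕ) (h : ι → R) (β : ι →₀ ℕ) (r : R) :
    kummerNormalForm e h (monomial β r) =
      monomial (Finsupp.equivFunOnFinite.symm fun i => β i % e i)
        (r * ∏ i, h i ^ (β i / e i)) := by
  have hr : monomial β r = r • basisMonomials ι R β := by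
    simp [coe_basisMonomials, smul_monomial]
  rw [hr, map_smul, kummerNormalForm, Module.Basis.constr_basis, smul_monomial, smul_eq_mul]

lemma map_kummerNormalForm {S : Type*} [CommRing S] (φ : R →+* S) (e : ι → ℕ) (h : ι → R)
    (p : MvPolynomial ι R) :
    map φ (kummerNormalForm e h p) = kummerNormalForm e (fun i => φ (h i)) (map φ p) := by
  induction p using MvPolynomial.induction_on' with
  | monomial β r => simp [kummerNormalForm_monomial, map_monomial]
  | add p q hp hq => simp [hp, hq]

lemma sub_kummerNormalForm_mem (e : ι → ℕ) (h : ι → R) (p : MvPolynomial ι R) :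
    p - kummerNormalForm e h p ∈ kummerIdeal e h := by
  induction p using MvPolynomial.induction_on' with
  | monomial β r =>
    rw [kummerNormalForm_monomial, ← Ideal.Quotient.mk_eq_mk_iff_sub_mem]
    have hX (i : ι) : Ideal.Quotient.mk (kummerIdeal e h) (X i) ^ e i =
        Ideal.Quotient.mk (kummerIdeal e h) (C (h i)) := by
      rw [← map_pow, Ideal.Quotient.mk_eq_mk_iff_sub_mem]
      exact Ideal.subset_span ⟨i, rfl⟩
    rw [monomial_eq, monomial_eq, Finsupp.prod_fintype _ _ (by simp),
      Finsupp.prod_fintype _ _ (by simp)]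
    simp only [map_mul, map_prod, map_pow, mul_assoc]
    rw [← Finset.prod_mul_distrib]
    congr 1
    refine Finset.prod_congr rfl fun i _ => ?_
    rw [← hX, ← pow_mul, Finsupp.equivFunOnFinite_symm_apply_apply, ← pow_add, Nat.div_add_mod]
  | add p q hp hq =>
    rw [map_add, add_sub_add_comm]
    exact add_mem hp hq

lemma kummerNormalForm_mul_X_pow (e : ι → ℕ) (he : ∀ i, e i ≠ 0) (h : ι → R) (i : ι)
    (p : MvPolynomial ι R) :
    kummerNormalForm e h (p * X i ^ e i) = h i • kummerNormalForm e h p := by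
  classical
  induction p using MvPolynomial.induction_on' with
  | monomial β r =>
    rw [X_pow_eq_monomial, monomial_mul, kummerNormalForm_monomial, kummerNormalForm_monomial,
      smul_monomial]
    have hmod (j : ι) : (β + Finsupp.single i (e i)) j % e j = β j % e j := by
      rcases eq_or_ne i j with rfl | hij <;> simp [*]
    have hdiv (j : ι) : h j ^ ((β + Finsupp.single i (e i)) j / e j) =
        (if j = i then h i else 1) * h j ^ (β j / e j) := by
      rcases eq_or_ne j i with rfl | hij
      · simp [Nat.add_div_right _ (Nat.pos_of_ne_zero (he j)), pow_succ, mul_comm]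
      · simp [hij]
    simp only [hmod, hdiv, Finset.prod_mul_distrib, Finset.prod_ite_eq', Finset.mem_univ, if_true,
      mul_one, smul_eq_mul]
    congr 1
    ring
  | add p q hp hq => rw [add_mul, map_add, hp, hq, map_add, smul_add]

lemma mem_kummerIdeal_iff (e : ι → ℕ) (he : ∀ i, e i ≠ 0) (h : ι → R) (p : MvPolynomial ι R) :
    p ∈ kummerIdeal e h ↔ kummerNormalForm e h p = 0 := by
  refine ⟨fun hp => ?_, fun hp => by simpa [hp] using sub_kummerNormalForm_mem e h p⟩
  suffices ∀ a, kummerNormalForm e h (a * p) = 0 by simpa using this 1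
  refine Submodule.span_induction (p := fun x _ => ∀ a, kummerNormalForm e h (a * x) = 0)
    ?_ (by simp) (fun x y _ _ hx hy a => by rw [mul_add, map_add, hx, hy, add_zero])
    (fun b x _ hx a => by rw [smul_eq_mul, ← mul_assoc, hx]) hp
  rintro _ ⟨i, rfl⟩ a
  rw [mul_sub, map_sub, kummerNormalForm_mul_X_pow e he, mul_comm a, ← smul_eq_C_mul, map_smul,
    sub_self]

/-- Over a field in which the exponents and constant terms do not vanish, the Kummer quotient is
unramified, hence reduced. -/
lemma kummerIdeal_isRadical_of_field {K : Type*} [Field K] (e : ι → ℕ) (h : ι → K)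
    (he : ∀ i, (e i : K) ≠ 0) (hh : ∀ i, h i ≠ 0) : (kummerIdeal e h).IsRadical := by
  rw [Ideal.isRadical_iff_quotient_reduced]
  set A := MvPolynomial ι K ⧸ kummerIdeal e h
  let D := KaehlerDifferential.D K A
  have hX (i : ι) : Ideal.Quotient.mkₐ K (kummerIdeal e h) (X i) ^ e i = algebraMap K A (h i) := by
    rw [← map_pow]
    exact (Ideal.Quotient.mk_eq_mk_iff_sub_mem _ _).2
      (Ideal.subset_span (Set.mem_range_self i))
  have hDX (i : ι) : D (Ideal.Quotient.mkₐ K (kummerIdeal e h) (X i)) = 0 := by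
    set y := Ideal.Quotient.mkₐ K (kummerIdeal e h) (X i)
    have he0 : e i ≠ 0 := fun h0 => he i (by simp [h0])
    have h1 : e i • y ^ (e i - 1) • D y = 0 := by
      rw [← Derivation.leibniz_pow, hX, Derivation.map_algebraMap]
    have h2 : ((e i : K) * h i) • D y = 0 := by
      rw [mul_smul, ← algebraMap_smul A (h i), ← hX, Nat.cast_smul_eq_nsmul,
        ← mul_pow_sub_one he0, mul_smul, ← smul_comm y, h1, smul_zero]
    exact (smul_eq_zero.1 h2).resolve_left (mul_ne_zero (he i) (hh i))
  have hD (a : A) : D a = 0 := by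
    obtain ⟨p, rfl⟩ := Ideal.Quotient.mkₐ_surjective K (kummerIdeal e h) a
    induction p using MvPolynomial.induction_on with
    | C r => exact D.map_algebraMap r
    | add p q hp hq => rw [map_add, map_add, hp, hq, add_zero]
    | mul_X p i hp => rw [map_mul, D.leibniz, hp, hDX, smul_zero, smul_zero, add_zero]
  have : Algebra.FormallyUnramified K A := by
    refine ⟨(subsingleton_iff_forall_eq 0).2 fun x => ?_⟩
    have hx : x ∈ Submodule.span A (Set.range (KaehlerDifferential.D K A)) := by
      rw [KaehlerDifferential.span_range_derivation]
      trivial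
    have hle : Submodule.span A (Set.range (KaehlerDifferential.D K A)) ≤ ⊥ :=
      Submodule.span_le.2 (by rintro _ ⟨a, rfl⟩; exact hD a)
    exact hle hx
  exact Algebra.FormallyUnramified.isReduced_of_field K A

lemma kummerIdeal_isRadical [IsDomain R] (e : ι → ℕ) (h : ι → R)
    (he : ∀ i, (e i : R) ≠ 0) (hh : ∀ i, h i ≠ 0) : (kummerIdeal e h).IsRadical := by
  let φ := algebraMap R (FractionRing R)
  have hφ : Function.Injective φ := IsFractionRing.injective R (FractionRing R)
  have he0 (i : ι) : e i ≠ 0 := fun h0 => he i (by simp [h0])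
  have hcomap : kummerIdeal e h = (kummerIdeal e fun i => φ (h i)).comap (map φ) := by
    ext p
    rw [Ideal.mem_comap, mem_kummerIdeal_iff e he0, mem_kummerIdeal_iff e he0,
      ← map_kummerNormalForm, map_eq_zero_iff _ (map_injective φ hφ)]
  rw [hcomap]
  refine Ideal.IsRadical.comap _ (kummerIdeal_isRadical_of_field e _ (fun i => ?_) fun i => ?_)
  · rw [← map_natCast φ]
    exact (map_ne_zero_iff φ hφ).2 (he i)
  · exact (map_ne_zero_iff φ hφ).2 (hh i)

end Kummer

lemma Ideal.span_range_sum_smul_le {ι κ F S : Type*} [Fintype ι] [CommSemiring F] [CommSemiring S]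
    [Algebra F S] (M : Matrix κ ι F) (u : ι → S) :
    Ideal.span (Set.range fun l => ∑ i, M l i • u i) ≤ Ideal.span (Set.range u) := by
  rw [Ideal.span_le]
  rintro _ ⟨l, rfl⟩
  exact Submodule.sum_mem _ fun i _ => Submodule.smul_of_tower_mem _ _
    (Ideal.subset_span (Set.mem_range_self i))

/-- An invertible change of generators does not change the ideal. -/
lemma Ideal.span_range_sum_smul {ι F S : Type*} [Fintype ι] [DecidableEq ι] [CommRing F]
    [CommRing S] [Algebra F S] (M : Matrix ι ι F) (hM : IsUnit M.det) (u : ι → S) :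
    Ideal.span (Set.range fun l => ∑ i, M l i • u i) = Ideal.span (Set.range u) := by
  refine le_antisymm (Ideal.span_range_sum_smul_le M u) ?_
  convert Ideal.span_range_sum_smul_le M⁻¹ fun l => ∑ i, M l i • u i
  rename_i i
  simp_rw [Finset.smul_sum, smul_smul]
  rw [Finset.sum_comm]
  simp_rw [← Finset.sum_smul, ← Matrix.mul_apply, Matrix.nonsing_inv_mul M hM, Matrix.one_apply,
    ite_smul, one_smul, zero_smul]
  simp

/-- The reduced form of the system: the ideal is radical as soon as the perturbations `w` do not
involve the last `n` variables and are not cancelled by row reduction. -/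
lemma isRadical_span_of_split {n m : ℕ} {F : Type*} [Field F] (e : Fin n → ℕ)
    (he : ∀ i, (e i : F) ≠ 0) (M : Matrix (Fin n) (Fin n) F) (hM : M.det ≠ 0)
    (w : Fin n → MvPolynomial (Fin m) F) (hw : ∀ l, ∑ i, M⁻¹ l i • w i ≠ 0)
    (f : Fin n → MvPolynomial (Fin (m + n)) F)
    (hf : ∀ i, f i = rename (Fin.castAdd n) (w i) +
      ∑ l, C (M i l) * X (Fin.natAdd m l) ^ e l) :
    (Ideal.span (Set.range f)).IsRadical := by
  let E : MvPolynomial (Fin (m + n)) F ≃ₐ[F] MvPolynomial (Fin n) (MvPolynomial (Fin m) F) :=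
    (renameEquiv F (finSumFinEquiv.symm.trans (Equiv.sumComm _ _))).trans (sumAlgEquiv F _ _)
  have hEX (l : Fin n) : E (X (Fin.natAdd m l)) = X l := by
    simp [E, sumAlgEquiv_X_inl]
  have hEw (p : MvPolynomial (Fin m) F) : E (rename (Fin.castAdd n) p) = C p := by
    simp only [E, AlgEquiv.trans_apply, renameEquiv_apply, rename_rename]
    rw [show (⇑(finSumFinEquiv.symm.trans (Equiv.sumComm (Fin m) (Fin n))) ∘ Fin.castAdd n) =
      Sum.inr from funext fun i => by simp]
    exact DFunLike.congr_fun (sumAlgEquiv_comp_rename_inr F _ _) p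
  have hEC (r : F) (p) : E (C r * p) = r • E p := by rw [← smul_eq_C_mul, map_smul]
  have hEf (i : Fin n) : E (f i) = C (w i) + ∑ l, M i l • X l ^ e l := by
    simp only [hf, map_add, hEw, map_sum, hEC, map_pow, hEX]
  have hMu : IsUnit M.det := isUnit_iff_ne_zero.2 hM
  have hmap : (Ideal.span (Set.range f)).map E =
      kummerIdeal e fun l => -∑ i, M⁻¹ l i • w i := by
    rw [Ideal.map_span, ← Set.range_comp, ← Ideal.span_range_sum_smul M⁻¹ (by
      simpa [Matrix.det_nonsing_inv] using hM), kummerIdeal]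
    congr! 3 with l
    simp only [Function.comp_apply, hEf, smul_add, Finset.sum_add_distrib, Finset.smul_sum,
      smul_smul, map_neg, sub_neg_eq_add]
    rw [Finset.sum_comm (γ := Fin n)]
    simp_rw [← Finset.sum_smul, ← Matrix.mul_apply, Matrix.nonsing_inv_mul M hMu,
      Matrix.one_apply, ite_smul, one_smul, zero_smul]
    rw [add_comm, map_sum]
    simp [Algebra.smul_def, algebraMap_eq]
  rw [← Ideal.comap_map_of_bijective E E.bijective (I := Ideal.span (Set.range f)), hmap]
  refine Ideal.IsRadical.comap _ (kummerIdeal_isRadical e _ (fun i => ?_) fun l => ?_)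
  · rw [← map_natCast (C : F →+* MvPolynomial (Fin m) F)]
    exact (map_ne_zero_iff _ (C_injective _ _)).2 (he i)
  · exact neg_ne_zero.2 (hw l)

/-- If all maximal minors of `A` are nonzero, then after reducing a set of `n` columns to the
identity all other entries are nonzero. -/
lemma sum_inv_submatrix_mul_ne_zero {n : ℕ} {τ F : Type*} [Field F]
    (A : Matrix (Fin n) τ F) (hA : ∀ φ : Fin n ↪ τ, (A.submatrix id φ).det ≠ 0)
    (φ : Fin n ↪ τ) (j : τ) (hj : j ∉ Set.range φ) (l : Fin n) :
    ∑ i, (A.submatrix id φ)⁻¹ l i * A i j ≠ 0 := by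
  classical
  intro h0
  let ψ : Fin n ↪ τ := ⟨Function.update φ l j, by
    intro a b hab
    have hj' (a : Fin n) : φ a ≠ j := fun h => hj ⟨a, h⟩
    by_cases ha : a = l <;> by_cases hb : b = l <;>
      simp_all [Function.update_apply, eq_comm]⟩
  have hψ : ⇑ψ = Function.update φ l j := rfl
  have hM := isUnit_iff_ne_zero.2 (hA φ)
  have hinv := Matrix.nonsing_inv_mul _ hM
  have hrow : (A.submatrix id φ)⁻¹ l = 0 := by
    refine Matrix.eq_zero_of_vecMul_eq_zero (hA ψ) (funext fun c => ?_)
    simp only [Matrix.vecMul, dotProduct, Matrix.submatrix_apply, id, Pi.zero_apply]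
    rcases eq_or_ne c l with rfl | hc
    · simpa [hψ] using h0
    · have := congr_fun (congr_fun hinv l) c
      rw [Matrix.mul_apply, Matrix.one_apply_ne hc.symm] at this
      simpa [hψ, hc] using this
  have := congr_fun (congr_fun hinv l) l
  simp [Matrix.mul_apply, hrow] at this

lemma exists_rename_castAdd_eq {n m k : ℕ} {F : Type*} [CommSemiring F] (hk : k ≤ m + n)
    (g : MvPolynomial (Fin k) F) (hg : g.totalDegree = 0 ∨ k ≤ m) :
    ∃ g' : MvPolynomial (Fin m) F, g'.totalDegree ≤ g.totalDegree ∧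
      rename (Fin.castLE hk) g = rename (Fin.castAdd n) g' := by
  rcases hg with hg | hkm
  · refine ⟨C (coeff 0 g), by simp, ?_⟩
    conv_lhs => rw [totalDegree_eq_zero_iff_eq_C.1 hg]
    simp
  · refine ⟨rename (Fin.castLE hkm) g, totalDegree_rename_le _ _, ?_⟩
    rw [rename_rename]
    rfl

/-- the ideal generated by the deformed diagonal polynomials is a
radical ideal, either when all the g_j are constants and n ≤ t − 2, or when the
g_j have degree < d_t, some g_i is nonconstant, and n ≤ (t−1)/2. -/
theorem diagonal_system_radical_ideal
    (q t n k : ℕ) (hq : IsPrimePow q)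
    (F : Type*) [Field F] [Fintype F] (hFq : Fintype.card F = q)
    (ht : 0 < t) (hk : 0 < k) (hkn : k ≤ n) (hn : 0 < n) (hnt : n ≤ t) (hkt : k ≤ t)
    (d : Fin t → ℕ) (hd : StrictAnti d) (hd2 : ∀ i, 2 ≤ d i)
    (hchar : ∀ i, ¬ (ringChar F ∣ d i))
    (A : Matrix (Fin n) (Fin t) F)
    (hH : ∀ φ : Fin n ↪ Fin t, (A.submatrix id φ).det ≠ 0)
    (g : Fin n → MvPolynomial (Fin k) F)
    (hcase :
      ((∀ j, (g j).totalDegree = 0) ∧ n + 2 ≤ t)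
      ∨ ((∀ j, (g j).totalDegree < d ⟨t - 1, Nat.sub_lt ht Nat.one_pos⟩)
          ∧ (∃ i, 0 < (g i).totalDegree) ∧ 2 * n + 1 ≤ t))
    (f : Fin n → MvPolynomial (Fin t) F)
    (hf : ∀ i, f i =
      (∑ j, MvPolynomial.C (A i j) * MvPolynomial.X j ^ d j)
        - MvPolynomial.rename (Fin.castLE hkt) (g i)) :
    (Ideal.span (Set.range f)).IsRadical := by
  obtain ⟨m, rfl⟩ : ∃ m, t = m + n := ⟨t - n, by omega⟩
  have hm : 0 < m := by rcases hcase with h | h <;> omega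
  have hgd (i : Fin n) (j : Fin (m + n)) : (g i).totalDegree < d j := by
    rcases hcase with h | h
    · rw [h.1]
      exact two_pos.trans_le (hd2 j)
    · exact (h.1 i).trans_le (hd.antitone (Fin.le_def.2 (Nat.le_sub_one_of_lt j.2)))
  have hex (i : Fin n) := exists_rename_castAdd_eq hkt (g i) (by
    rcases hcase with h | h
    · exact Or.inl (h.1 i)
    · exact Or.inr (by omega))
  choose g' hdeg hg' using hex
  let φ : Fin n ↪ Fin (m + n) := Fin.natAddEmb m
  let w (i : Fin n) : MvPolynomial (Fin m) F :=
    ∑ j, C (A i (Fin.castAdd n j)) * X j ^ d (Fin.castAdd n j) - g' i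
  refine isRadical_span_of_split (fun l => d (Fin.natAdd m l))
    (fun i h => hchar _ (ringChar.dvd h)) (A.submatrix id φ) (hH φ) w (fun l hl => ?_) f fun i => ?_
  · let j₀ : Fin m := ⟨0, hm⟩
    have hcoeff (i : Fin n) :
        coeff (Finsupp.single j₀ (d (Fin.castAdd n j₀))) (w i) = A i (Fin.castAdd n j₀) := by
      have hd0 : d (Fin.castAdd n j₀) ≠ 0 := by have := hd2 (Fin.castAdd n j₀); omega
      have hg0 : coeff (Finsupp.single j₀ (d (Fin.castAdd n j₀))) (g' i) = 0 := by
        apply coeff_eq_zero_of_totalDegree_lt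
        rw [Finsupp.support_single _ hd0, Finset.sum_singleton, Finsupp.single_eq_same]
        exact (hdeg i).trans_lt (hgd i _)
      rw [coeff_sub, hg0, sub_zero, coeff_sum, Finset.sum_eq_single j₀]
      · rw [coeff_C_mul, coeff_X_pow, if_pos rfl, mul_one]
      · intro j _ hj
        rw [coeff_C_mul, coeff_X_pow, if_neg, mul_zero]
        intro h
        rcases Finsupp.single_eq_single_iff _ _ _ _ |>.1 h with h | h
        · exact hj h.1
        · exact hd0 h.2
      · simp
    refine sum_inv_submatrix_mul_ne_zero A hH φ (Fin.castAdd n j₀) ?_ l ?_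
    · rintro ⟨a, ha⟩
      have := congr_arg Fin.val ha
      simp [φ, j₀] at this
      omega
    · have := congr_arg (coeff (Finsupp.single j₀ (d (Fin.castAdd n j₀)))) hl
      simpa [coeff_sum, hcoeff] using this
  · rw [hf, Fin.sum_univ_add, hg']
    simp only [w, map_sub, map_sum, map_mul, map_pow, rename_C, rename_X, Matrix.submatrix_apply,
      id, φ, Fin.natAddEmb_apply]
    rw [sub_add_eq_add_sub]
end

section
/- Let q be a prime power and 𝔽_q the finite field with q elements. Let t ≥ 3 and d_1 > d_2 > ⋯ > d_t ≥ 2 be integers with char(𝔽_q) not dividing d_i for 1 ≤ i ≤ t. Let a_1, …, a_t ∈ 𝔽_q be all nonzero and let g ∈ 𝔽_q[X] be a univariate polynomial with 0 < deg(g) < d_t. Let N be the number of tuples x = (x_1, …, x_t) ∈ 𝔽_q^t with a_1 x_1^{d_1} + a_2 x_2^{d_2} + ⋯ + a_t x_t^{d_t} = g(x_1). Then |N − q^{t−1}| ≤ q^{t/2} · (6 d_1)^{t+1}. -/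
open Polynomial in
/-- A nonconstant polynomial takes each value at most as often as its degree. -/
lemma card_filter_eval_eq_le {F : Type*} [Field F] [Fintype F] [DecidableEq F]
    {P : F[X]} (hP : 0 < P.natDegree) (b : F) :
    (Finset.univ.filter fun x => P.eval x = b).card ≤ P.natDegree := by
  have hne : P - C b ≠ 0 := fun h => by
    rw [sub_eq_zero.mp h, natDegree_C] at hP
    exact lt_irrefl _ hP
  have hsub : (Finset.univ.filter fun x => P.eval x = b) ⊆ (P - C b).roots.toFinset := by
    intro x hx
    have hx' : P.eval x = b := by simpa using hx
    simp [hne, hx']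
  calc _ ≤ (P - C b).roots.toFinset.card := Finset.card_le_card hsub
    _ ≤ Multiset.card (P - C b).roots := Multiset.toFinset_card_le _
    _ ≤ (P - C b).natDegree := card_roots' _
    _ = P.natDegree := natDegree_sub_C

/-- The exponential sum of `c * f` with respect to an additive character. -/
noncomputable def charSum {F : Type*} [Field F] [Fintype F] (ψ : AddChar F ℂ)
    (f : F → F) (c : F) : ℂ :=
  ∑ x, ψ (c * f x)

section charSum

variable {F : Type*} [Field F] [Fintype F] {ψ : AddChar F ℂ}

lemma charSum_zero (f : F → F) : charSum ψ f 0 = Fintype.card F := by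
  simp [charSum]

variable [DecidableEq F]

lemma sum_prod_charSum (hψ : ψ.IsPrimitive) {ι : Type*} [Fintype ι] [DecidableEq ι]
    (f : ι → F → F) :
    ∑ c, ∏ j, charSum ψ (f j) c =
      Fintype.card F * ((Finset.univ.filter fun x : ι → F => ∑ j, f j (x j) = 0).card : ℂ) := by
  have h (c : F) : ∏ j, charSum ψ (f j) c = ∑ x : ι → F, ψ (c * ∑ j, f j (x j)) := by
    simp only [charSum, Finset.prod_univ_sum, Fintype.piFinset_univ, Finset.mul_sum]
    exact Finset.sum_congr rfl fun x _ =>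
      (map_prod ψ.toMonoidHom (fun i => Multiplicative.ofAdd (c * f i (x i))) _).symm
  simp_rw [h]
  rw [Finset.sum_comm]
  simp_rw [AddChar.sum_mulShift _ hψ]
  rw [Finset.card_filter]
  push_cast
  rw [Finset.mul_sum]
  simp

/-- Parseval's identity for the exponential sums of `f`. -/
lemma sum_norm_charSum_sq (hψ : ψ.IsPrimitive) (f : F → F) :
    ∑ c, ‖charSum ψ f c‖ ^ 2 =
      Fintype.card F * ∑ y, ((Finset.univ.filter fun x => f x = f y).card : ℝ) := by
  have h (c : F) : ((‖charSum ψ f c‖ ^ 2 : ℝ) : ℂ) = ∑ y, ∑ x, ψ (c * (f x - f y)) := by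
    push_cast
    rw [← Complex.mul_conj']
    simp only [charSum, map_sum, ← AddChar.map_neg_eq_conj]
    rw [Finset.sum_mul_sum, Finset.sum_comm]
    refine Finset.sum_congr rfl fun y _ => Finset.sum_congr rfl fun x _ => ?_
    rw [← AddChar.map_add_eq_mul]
    ring_nf
  apply Complex.ofReal_injective
  rw [Complex.ofReal_sum]
  simp_rw [h]
  rw [Finset.sum_comm, Finset.sum_congr rfl fun y _ => Finset.sum_comm]
  simp_rw [AddChar.sum_mulShift _ hψ, sub_eq_zero]
  simp [Finset.mul_sum, ← Finset.sum_filter, mul_comm]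

open Polynomial in
lemma sum_norm_charSum_eval_sq_le (hψ : ψ.IsPrimitive) {P : F[X]} (hP : 0 < P.natDegree) :
    ∑ c, ‖charSum ψ (fun x => P.eval x) c‖ ^ 2 ≤ (Fintype.card F : ℝ) ^ 2 * P.natDegree := by
  rw [sum_norm_charSum_sq hψ, pow_two, mul_assoc]
  gcongr
  calc _ ≤ ∑ _y : F, (P.natDegree : ℝ) :=
        Finset.sum_le_sum fun y _ => by exact_mod_cast card_filter_eval_eq_le hP _
    _ = _ := by simp

open Polynomial in
/-- On average over all frequencies, a polynomial exponential sum has square-root size. -/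
lemma sum_norm_charSum_eval_le (hψ : ψ.IsPrimitive) {P : F[X]} (hP : 0 < P.natDegree) :
    ∑ c, ‖charSum ψ (fun x => P.eval x) c‖ ≤ √(Fintype.card F : ℝ) ^ 3 * P.natDegree := by
  refine le_of_sq_le_sq ?_ (by positivity)
  have hcs := sq_sum_le_card_mul_sum_sq (s := (Finset.univ : Finset F))
    (f := fun c => ‖charSum ψ (fun x => P.eval x) c‖)
  have hq : √(Fintype.card F : ℝ) ^ 2 = Fintype.card F := Real.sq_sqrt (by positivity)
  have hd : (1 : ℝ) ≤ P.natDegree := by exact_mod_cast hP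
  calc _ ≤ _ := hcs
    _ ≤ (Fintype.card F : ℝ) * ((Fintype.card F : ℝ) ^ 2 * P.natDegree) := by
        rw [Finset.card_univ]
        gcongr
        exact sum_norm_charSum_eval_sq_le hψ hP
    _ ≤ (Fintype.card F : ℝ) ^ 3 * (P.natDegree : ℝ) ^ 2 := by
        rw [← mul_assoc, ← pow_succ']
        gcongr
        nlinarith
    _ = (√(Fintype.card F : ℝ) ^ 3 * P.natDegree) ^ 2 := by
        rw [mul_pow, ← pow_mul, mul_comm 3 2, pow_mul, hq]

open Polynomial in
/-- The Gauss-type bound for exponential sums of monomials, up to the constant. -/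
lemma norm_charSum_monomial_le (hψ : ψ.IsPrimitive) {a c : F} (ha : a ≠ 0) (hc : c ≠ 0)
    {d : ℕ} (hd : 0 < d) :
    ‖charSum ψ (fun x => a * x ^ d) c‖ ≤ 2 * d * √(Fintype.card F : ℝ) := by
  set S : F → ℝ := fun b => ‖charSum ψ (fun x => a * x ^ d) b‖ ^ 2 with hS
  have hinv (u : F) (hu : u ≠ 0) : S (c * u ^ d) = S c := by
    have : charSum ψ (fun x => a * x ^ d) (c * u ^ d) = charSum ψ (fun x => a * x ^ d) c := by
      refine Fintype.sum_bijective _ (mulLeft_bijective₀ u hu) _ _ fun x => ?_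
      ring_nf
    simp only [hS, this]
  have htotal : ∑ b, S b ≤ (Fintype.card F : ℝ) ^ 2 * d := by
    have h := sum_norm_charSum_eval_sq_le hψ (P := C a * X ^ d)
      (by rwa [natDegree_C_mul_X_pow d a ha])
    rw [natDegree_C_mul_X_pow d a ha] at h
    simpa using h
  have hfiber : ∑ u, S (c * u ^ d) ≤ d * ∑ b, S b := by
    rw [← Finset.sum_fiberwise (s := Finset.univ) (g := fun u => c * u ^ d), Finset.mul_sum]
    refine Finset.sum_le_sum fun b _ => ?_
    rw [Finset.sum_congr rfl (g := fun _ => S b) fun u hu => by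
      rw [(Finset.mem_filter.mp hu).2], Finset.sum_const, nsmul_eq_mul]
    have h := card_filter_eval_eq_le (P := C c * X ^ d)
      (by rwa [natDegree_C_mul_X_pow d c hc]) b
    rw [natDegree_C_mul_X_pow d c hc] at h
    simp only [eval_mul, eval_C, eval_pow, eval_X] at h
    have hSb : 0 ≤ S b := by positivity
    gcongr
  have hlower : ((Fintype.card F : ℝ) - 1) * S c ≤ ∑ u, S (c * u ^ d) := by
    calc _ = ∑ u ∈ Finset.univ.erase (0 : F), S (c * u ^ d) := by
          rw [Finset.sum_congr rfl fun u hu => hinv u (Finset.ne_of_mem_erase hu),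
            Finset.sum_const, Finset.card_erase_of_mem (Finset.mem_univ _), Finset.card_univ,
            nsmul_eq_mul, Nat.cast_sub Fintype.card_pos, Nat.cast_one]
      _ ≤ _ := Finset.sum_le_sum_of_subset_of_nonneg (Finset.erase_subset _ _)
          fun _ _ _ => by positivity
  have hq2 : (2 : ℝ) ≤ Fintype.card F := by exact_mod_cast Fintype.one_lt_card (α := F)
  have hSc : 0 ≤ S c := by positivity
  have hd' : (0 : ℝ) ≤ d := by positivity
  have hmain : (Fintype.card F : ℝ) * S c ≤ Fintype.card F * (2 * d ^ 2 * Fintype.card F) := by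
    nlinarith [mul_le_mul_of_nonneg_left htotal hd', mul_nonneg (sub_nonneg.mpr hq2) hSc]
  have hle : S c ≤ 2 * d ^ 2 * Fintype.card F := le_of_mul_le_mul_left hmain (by linarith)
  refine le_of_sq_le_sq ?_ (by positivity)
  rw [mul_pow, Real.sq_sqrt (by positivity)]
  have : 0 ≤ (d : ℝ) ^ 2 * Fintype.card F := by positivity
  linarith

end charSum


/-- estimate for a single deformed diagonal equation whose
right-hand side is a univariate polynomial in the first variable. -/
theorem single_deformed_diagonal_equation_estimate
    (q t : ℕ) (hq : IsPrimePow q)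
    (F : Type*) [Field F] [Fintype F] (hFq : Fintype.card F = q)
    (ht : 3 ≤ t) (ht0 : 0 < t)
    (d : Fin t → ℕ) (hd : StrictAnti d) (hd2 : ∀ i, 2 ≤ d i)
    (hchar : ∀ i, ¬ (ringChar F ∣ d i))
    (a : Fin t → F) (ha : ∀ i, a i ≠ 0)
    (g : Polynomial F) (hg0 : 0 < g.natDegree)
    (hgd : g.natDegree < d ⟨t - 1, Nat.sub_lt ht0 Nat.one_pos⟩)
    (N : ℕ)
    (hN : N = Set.ncard {x : Fin t → F |
      ∑ j, a j * x j ^ d j = Polynomial.eval (x ⟨0, ht0⟩) g}) :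
    |(N : ℝ) - (q : ℝ) ^ (t - 1)|
      ≤ (q : ℝ) ^ ((t : ℝ) / 2)
        * ((6 * d ⟨0, ht0⟩ : ℕ) : ℝ) ^ (t + 1) := by
  classical
  subst hFq
  set P : Polynomial F := Polynomial.C (a ⟨0, ht0⟩) * Polynomial.X ^ d ⟨0, ht0⟩ - g with hPdef
  have hd0 (j : Fin t) : d j ≤ d ⟨0, ht0⟩ := hd.antitone (Fin.mk_le_mk.mpr (Nat.zero_le _))
  have hPdeg : P.natDegree = d ⟨0, ht0⟩ := by
    have hm := Polynomial.natDegree_C_mul_X_pow (d ⟨0, ht0⟩) _ (ha ⟨0, ht0⟩)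
    rw [hPdef, Polynomial.natDegree_sub_eq_left_of_natDegree_lt, hm]
    rw [hm]
    exact hgd.trans_le (hd0 _)
  have hPpos : 0 < P.natDegree := hPdeg ▸ (Nat.zero_lt_two.trans_le (hd2 _))
  set ι₀ : Fin t := ⟨0, ht0⟩ with hι₀
  set f : Fin t → F → F :=
    Function.update (fun j x => a j * x ^ d j) ι₀ (fun x => P.eval x) with hf
  have hcount : N = (Finset.univ.filter fun x : Fin t → F => ∑ j, f j (x j) = 0).card := by
    rw [hN, ← Set.ncard_coe_finset]
    congr 1
    ext x
    have hsum : ∑ j, f j (x j) = ∑ j, a j * x j ^ d j - g.eval (x ι₀) := by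
      rw [← Finset.add_sum_erase _ _ (Finset.mem_univ ι₀),
        ← Finset.add_sum_erase _ (fun j => a j * x j ^ d j) (Finset.mem_univ ι₀),
        Finset.sum_congr rfl (g := fun j => a j * x j ^ d j) fun j hj => by
          rw [hf, Function.update_of_ne (Finset.ne_of_mem_erase hj)]]
      simp only [hf, Function.update_self, hPdef, Polynomial.eval_sub, Polynomial.eval_mul,
        Polynomial.eval_C, Polynomial.eval_pow, Polynomial.eval_X]
      ring
    simp [hsum, sub_eq_zero]
  obtain ⟨ψ, hψ⟩ : ∃ ψ : AddChar F ℂ, ψ.IsPrimitive :=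
    ⟨_, AddChar.FiniteField.primitiveChar_to_Complex_isPrimitive F⟩
  have hid := sum_prod_charSum hψ f
  rw [← hcount, ← Finset.add_sum_erase _ _ (Finset.mem_univ 0)] at hid
  simp only [charSum_zero, Finset.prod_const, Finset.card_univ, Fintype.card_fin] at hid
  set q : ℝ := ((Fintype.card F : ℕ) : ℝ) with hqdef
  have hqpos : 0 < q := by
    rw [hqdef]
    exact_mod_cast Fintype.card_pos (α := F)
  set D : ℝ := ((d ι₀ : ℕ) : ℝ) with hD
  have hD1 : 1 ≤ D := by
    rw [hD]
    exact_mod_cast one_le_two.trans (hd2 ι₀)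
  have hterm (c : F) (hc : c ≠ 0) :
      ‖∏ j, charSum ψ (f j) c‖ ≤ ‖charSum ψ (fun x => P.eval x) c‖ * (2 * D * √q) ^ (t - 1) := by
    rw [← Finset.mul_prod_erase _ _ (Finset.mem_univ ι₀), norm_mul, norm_prod]
    have h0 : f ι₀ = fun x => P.eval x := Function.update_self ..
    rw [h0]
    gcongr
    calc _ ≤ ∏ _j ∈ Finset.univ.erase ι₀, (2 * D * √q) := by
          refine Finset.prod_le_prod (fun _ _ => norm_nonneg _) fun j hj => ?_
          have hfj : f j = fun x => a j * x ^ d j :=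
            Function.update_of_ne (Finset.ne_of_mem_erase hj) ..
          rw [hfj]
          refine (norm_charSum_monomial_le hψ (ha j) hc
            (Nat.zero_lt_two.trans_le (hd2 j))).trans ?_
          have : (d j : ℝ) ≤ D := Nat.cast_le.mpr (hd0 j)
          gcongr
      _ = _ := by simp
  have hbound : ‖∑ c ∈ Finset.univ.erase 0, ∏ j, charSum ψ (f j) c‖
      ≤ √q ^ 3 * D * (2 * D * √q) ^ (t - 1) := by
    calc _ ≤ ∑ c ∈ Finset.univ.erase 0,
          ‖charSum ψ (fun x => P.eval x) c‖ * (2 * D * √q) ^ (t - 1) :=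
          norm_sum_le_of_le _ fun c hc => hterm c (Finset.ne_of_mem_erase hc)
      _ ≤ ∑ c, ‖charSum ψ (fun x => P.eval x) c‖ * (2 * D * √q) ^ (t - 1) :=
          Finset.sum_le_sum_of_subset_of_nonneg (Finset.erase_subset _ _)
            fun _ _ _ => by positivity
      _ ≤ _ := by
          rw [← Finset.sum_mul]
          gcongr
          have h := sum_norm_charSum_eval_le hψ hPpos
          rwa [hPdeg] at h
  have hsqrt : √q ^ 2 = q := Real.sq_sqrt hqpos.le
  have hscaled : q * |(N : ℝ) - q ^ (t - 1)| ≤ q * (√q ^ t * (2 ^ (t - 1) * D ^ t)) := by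
    have hdiff : ∑ c ∈ Finset.univ.erase 0, ∏ j, charSum ψ (f j) c
        = ((q * (N - q ^ (t - 1)) : ℝ) : ℂ) := by
      rw [mul_sub, mul_pow_sub_one (by omega)]
      push_cast [hqdef]
      rw [← hid]
      ring
    rw [hdiff, Complex.norm_real, Real.norm_eq_abs, abs_mul, abs_of_pos hqpos] at hbound
    refine hbound.trans_eq ?_
    obtain ⟨s, rfl⟩ : ∃ s, t = s + 1 := ⟨t - 1, by omega⟩
    rw [Nat.add_sub_cancel]
    nth_rewrite 3 [← hsqrt]
    ring
  have hfinal := le_of_mul_le_mul_left hscaled hqpos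
  have hrpow : q ^ ((t : ℝ) / 2) = √q ^ t := by
    rw [Real.sqrt_eq_rpow, ← Real.rpow_mul_natCast hqpos.le]
    ring_nf
  rw [hrpow]
  refine hfinal.trans ?_
  gcongr
  push_cast
  rw [mul_pow]
  gcongr ?_ * ?_
  · calc (2 : ℝ) ^ (t - 1) ≤ 6 ^ (t - 1) := by gcongr; norm_num
      _ ≤ 6 ^ (t + 1) := by
        gcongr
        · norm_num
        · omega
  · gcongr
    exact Nat.le_succ t
end

section
/- Let q be a prime power and 𝔽_q the finite field with q elements. Let t, n, d_1, …, d_t be positive integers with n < (t−1)/2, d_1 > d_2 > ⋯ > d_t ≥ 2, and suppose char(𝔽_q) does not divide d_i for 1 ≤ i ≤ t. Let A = (a_{ij}) ∈ 𝔽_q^{n×t} satisfy hypothesis (H). Let c_{jl} (1 ≤ j, l ≤ n) be positive integers with c_{j1} + ⋯ + c_{jn} < d_t for every j, let a_1, …, a_n ∈ 𝔽_q with a_j ≠ 0 for at least one j, and let b_1, …, b_n ∈ 𝔽_q all be nonzero. For a subset S ⊆ {1, …, t} with |S| = i, let N_S be the number of tuples x = (x_1, …, x_t) ∈ 𝔽_q^t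 such that x_j = 0 for all j ∈ S and ∑_{l=1}^t a_{jl} x_l^{d_l} + a_j = b_j · x_1^{c_{j1}} ⋯ x_n^{c_{jn}} for every 1 ≤ j ≤ n. Then: (i) if 1 ≤ i ≤ t − 2n − 1, then |N_S − q^{t−i−n}| ≤ q^{(t−i)/2} · (6 n d_1)^{t−i+1}; (ii) if t − 2n ≤ i ≤ t − n, then N_S ≤ d_1^n · q^{t−n−i}; (iii) if t − n + 1 ≤ i ≤ t, then N_S ≤ d_1^n. -/
/-- A finite set of points on which every `x l ^ e l` agrees with a combination of monomials of total
degree less than `e l` has at most `∏ l, e l` elements. -/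
theorem card_le_prod_of_pow_eq_lower {F σ J : Type*} [Field F] [Fintype F] [Fintype σ] [Fintype J]
    (X : Finset (σ → F)) (e : σ → ℕ) (he : ∀ l, 0 < e l) (κ : σ → F) (β : σ → J → F)
    (c : J → σ → ℕ) (hc : ∀ j l, ∑ i, c j i < e l)
    (hX : ∀ x ∈ X, ∀ l, x l ^ e l = κ l + ∑ j, β l j * ∏ i, x i ^ c j i) :
    X.card ≤ ∏ l, e l := by
  classical
  let mon : (σ → ℕ) → (X → F) := fun k x => ∏ i, x.1 i ^ k i
  let red : ((l : σ) → Fin (e l)) → (X → F) := fun k => mon fun l => k l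
  have hmon : ∀ N, ∀ k : σ → ℕ, ∑ i, k i = N → mon k ∈ Submodule.span F (Set.range red) := by
    intro N
    induction N using Nat.strong_induction_on with
    | _ N ih =>
      intro k hk
      by_cases hlt : ∀ l, k l < e l
      · exact Submodule.subset_span ⟨fun l => ⟨k l, hlt l⟩, rfl⟩
      · push Not at hlt
        obtain ⟨l, hl⟩ := hlt
        set k' : σ → ℕ := fun i => k i - Pi.single (M := fun _ => ℕ) l (e l) i with hk'
        have hkk : ∀ i, k i = k' i + Pi.single (M := fun _ => ℕ) l (e l) i := by
          intro i
          by_cases h : i = l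
          · subst h; simp [hk', hl]
          · simp [hk', h]
        have hsum : ∑ i, k i = ∑ i, k' i + e l := by
          rw [Finset.sum_congr rfl fun i _ => hkk i, Finset.sum_add_distrib]
          simp
        have hexp : mon k = κ l • mon k' + ∑ j, β l j • mon (k' + c j) := by
          ext x
          have h1 : mon k x = mon k' x * x.1 l ^ e l := by
            simp only [mon]
            rw [Finset.prod_congr rfl fun i _ => by rw [hkk i, pow_add], Finset.prod_mul_distrib]
            congr 1
            rw [Finset.prod_eq_single l]
            · simp
            · intro i _ hi
              simp [hi]
            · simp
          rw [h1, hX x.1 x.2 l, mul_add, Finset.mul_sum]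
          simp only [Pi.add_apply, Pi.smul_apply, Finset.sum_apply, smul_eq_mul, mon, pow_add,
            Finset.prod_mul_distrib]
          congr 1
          · ring
          · exact Finset.sum_congr rfl fun j _ => by ring
        rw [hexp]
        refine Submodule.add_mem _ (Submodule.smul_mem _ _ (ih _ ?_ k' rfl))
          (Submodule.sum_mem _ fun j _ => Submodule.smul_mem _ _ (ih _ ?_ _ rfl))
        · have := he l
          omega
        · have := hc j l
          simp only [Pi.add_apply, Finset.sum_add_distrib]
          omega
  have htop : Submodule.span F (Set.range red) = ⊤ := by
    rw [eq_top_iff]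
    intro f _
    have hf : (fun x : σ → F => if h : x ∈ X then f ⟨x, h⟩ else 0) ∈
        (MvPolynomial.restrictDegree σ F (Fintype.card F - 1)).map (MvPolynomial.evalₗ F σ) := by
      rw [MvPolynomial.map_restrict_dom_evalₗ]; trivial
    obtain ⟨p, -, hp⟩ := hf
    have : f = ∑ k ∈ p.support, p.coeff k • mon k := by
      ext x
      have h := congrFun hp x.1
      simp only [MvPolynomial.evalₗ_apply, MvPolynomial.eval_eq', x.2, dif_pos] at h
      simp only [Finset.sum_apply, Pi.smul_apply, smul_eq_mul, mon]
      exact h.symm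
    rw [this]
    exact Submodule.sum_mem _ fun k _ => Submodule.smul_mem _ _ (hmon _ k rfl)
  have h := finrank_range_le_card (R := F) red
  rw [Set.finrank, htop, finrank_top, Module.finrank_fintype_fun_eq_card] at h
  simpa using h

theorem AddChar.map_finsetSum_eq_prod {G M ι : Type*} [AddCommMonoid G] [CommMonoid M] (ψ : AddChar G M)
    (s : Finset ι) (f : ι → G) : ψ (∑ i ∈ s, f i) = ∏ i ∈ s, ψ (f i) := by
  classical
  induction s using Finset.induction_on with
  | empty => simp
  | insert i s hi ih => rw [Finset.sum_insert hi, Finset.prod_insert hi, map_add_eq_mul, ih]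

theorem sum_addChar_dotProduct {F J : Type*} [Field F] [Fintype F] [Fintype J] [DecidableEq J]
    [DecidableEq F] {ψ : AddChar F ℂ} (hψ : ψ.IsPrimitive) (v : J → F) :
    ∑ u : J → F, ψ (u ⬝ᵥ v) = if v = 0 then (Fintype.card F : ℂ) ^ Fintype.card J else 0 := by
  have h1 : ∀ u : J → F, ψ (u ⬝ᵥ v) = ∏ j, ψ (u j * v j) := fun u => by
    rw [dotProduct, AddChar.map_finsetSum_eq_prod]
  simp_rw [h1]
  rw [← Fintype.piFinset_univ, ← Finset.prod_univ_sum (fun _ => Finset.univ) fun j x => ψ (x * v j)]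
  simp_rw [AddChar.sum_mulShift _ hψ]
  split_ifs with hv
  · simp [hv]
  · obtain ⟨j, hj⟩ := Function.ne_iff.mp hv
    exact Finset.prod_eq_zero (Finset.mem_univ j) (by simpa using hj)

/-- Parseval's identity for the fibre counts of a map `H` into `J → F`. -/
theorem sum_normSq_sum_addChar {F J Z : Type*} [Field F] [Fintype F] [Fintype J] [DecidableEq J]
    [DecidableEq F] [Fintype Z] {ψ : AddChar F ℂ} (hψ : ψ.IsPrimitive) (H : Z → J → F) :
    ∑ u : J → F, ‖∑ z, ψ (u ⬝ᵥ H z)‖ ^ 2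
      = (Fintype.card F : ℝ) ^ Fintype.card J
        * ∑ v, ((Finset.univ.filter fun z => H z = v).card : ℝ) ^ 2 := by
  have h1 : ∀ u : J → F, ((‖∑ z, ψ (u ⬝ᵥ H z)‖ ^ 2 : ℝ) : ℂ)
      = ∑ z, ∑ z', ψ (u ⬝ᵥ (H z - H z')) := by
    intro u
    rw [Complex.ofReal_pow, ← Complex.mul_conj', map_sum, Finset.sum_mul_sum]
    refine Finset.sum_congr rfl fun z _ => Finset.sum_congr rfl fun z' _ => ?_
    rw [← AddChar.map_neg_eq_conj, ← AddChar.map_add_eq_mul, dotProduct_sub, sub_eq_add_neg]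
  have h2 : ∑ v, ((Finset.univ.filter fun z => H z = v).card : ℂ) ^ 2
      = ∑ z, ∑ z', if H z - H z' = 0 then (1 : ℂ) else 0 := by
    have : ∀ v, ((Finset.univ.filter fun z => H z = v).card : ℂ) ^ 2
        = ∑ z, ∑ z', if H z = v then (if H z' = v then (1 : ℂ) else 0) else 0 := by
      intro v
      rw [sq, Finset.card_filter]
      push_cast
      rw [Finset.sum_mul_sum]
      refine Finset.sum_congr rfl fun z _ => Finset.sum_congr rfl fun z' _ => ?_
      split_ifs <;> simp
    simp_rw [this]
    rw [Finset.sum_comm]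
    refine Finset.sum_congr rfl fun z _ => ?_
    rw [Finset.sum_comm]
    refine Finset.sum_congr rfl fun z' _ => ?_
    simp [sub_eq_zero, eq_comm]
  have h3 : ((∑ u : J → F, ‖∑ z, ψ (u ⬝ᵥ H z)‖ ^ 2 : ℝ) : ℂ)
      = (((Fintype.card F : ℝ) ^ Fintype.card J
        * ∑ v, ((Finset.univ.filter fun z => H z = v).card : ℝ) ^ 2 : ℝ) : ℂ) := by
    push_cast at h1 ⊢
    rw [Finset.sum_congr rfl fun u _ => h1 u, h2, Finset.sum_comm, Finset.mul_sum]
    refine Finset.sum_congr rfl fun z _ => ?_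
    rw [Finset.sum_comm, Finset.mul_sum]
    refine Finset.sum_congr rfl fun z' _ => ?_
    rw [sum_addChar_dotProduct hψ]
    simp
  exact_mod_cast h3

theorem card_pow_eq_le_s12 {F : Type*} [Field F] [Fintype F] [DecidableEq F] {k : ℕ} (hk : 0 < k)
    (y : F) : (Finset.univ.filter fun x : F => x ^ k = y).card ≤ k := by
  refine le_trans (Finset.card_le_card ?_)
    ((Multiset.toFinset_card_le _).trans (Polynomial.card_nthRoots k y))
  intro x hx
  rw [Multiset.mem_toFinset, Polynomial.mem_nthRoots hk]
  simpa using hx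

/-- The elementary Weyl bound for a monomial character sum. -/
theorem normSq_sum_addChar_mul_pow_le {F : Type*} [Field F] [Fintype F]
    {ψ : AddChar F ℂ} (hψ : ψ.IsPrimitive) {k : ℕ} (hk : 0 < k) {c : F} (hc : c ≠ 0) :
    ‖∑ x, ψ (c * x ^ k)‖ ^ 2 ≤ (k : ℝ) ^ 2 * Fintype.card F := by
  classical
  set q : ℝ := (Fintype.card F : ℝ) with hq
  have hq1 : 1 < q := by rw [hq]; exact_mod_cast Fintype.one_lt_card
  have hk1 : (1 : ℝ) ≤ k := by exact_mod_cast hk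
  set w : F → ℝ := fun c => ‖∑ x, ψ (c * x ^ k)‖ ^ 2 with hw
  have hinv : ∀ z : F, z ≠ 0 → w (c * z ^ k) = w c := by
    intro z hz
    simp only [hw]
    rw [← Equiv.sum_comp (Equiv.mulLeft₀ z hz) fun x => ψ (c * x ^ k)]
    simp [mul_pow, mul_assoc]
  have hw0 : w 0 = q ^ 2 := by simp [hw, hq]
  have hpars : ∑ u, w u = q * ∑ v, ((Finset.univ.filter fun x : F => x ^ k = v).card : ℝ) ^ 2 := by
    have h := sum_normSq_sum_addChar hψ (J := Unit) (fun (x : F) (_ : Unit) => x ^ k)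
    rw [← Equiv.sum_comp (Equiv.funUnique Unit F).symm,
      ← Equiv.sum_comp (Equiv.funUnique Unit F).symm] at h
    simpa [dotProduct, funext_iff] using h
  have hfib : ∑ v, ((Finset.univ.filter fun x : F => x ^ k = v).card : ℝ) ^ 2
      ≤ 1 + (q - 1) * k := by
    rw [← Finset.add_sum_erase _ _ (Finset.mem_univ (0 : F))]
    have h0 : (Finset.univ.filter fun x : F => x ^ k = 0).card = 1 := by
      rw [Finset.card_eq_one]
      exact ⟨0, by ext x; simp [hk.ne']⟩
    have hsum : ∑ v ∈ Finset.univ.erase (0 : F),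
        ((Finset.univ.filter fun x : F => x ^ k = v).card : ℝ) = q - 1 := by
      have h : ∑ v : F, ((Finset.univ.filter fun x : F => x ^ k = v).card : ℝ) = q := by
        rw [hq, ← Finset.card_univ, Finset.card_eq_sum_card_fiberwise (f := fun x : F => x ^ k)
          (t := Finset.univ) (fun x _ => by simp)]
        push_cast
        rfl
      rw [← Finset.add_sum_erase _ _ (Finset.mem_univ (0 : F)), h0] at h
      push_cast at h
      linarith
    rw [h0, ← hsum, Finset.sum_mul]
    push_cast
    rw [one_pow]
    gcongr with v _
    rw [sq]
    gcongr
    exact card_pow_eq_le_s12 hk v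
  have hlow : (q - 1) * w c ≤ k * ∑ u ∈ Finset.univ.erase (0 : F), w u := by
    have h1 : (q - 1) * w c = ∑ z ∈ Finset.univ.erase (0 : F), w (c * z ^ k) := by
      rw [Finset.sum_congr rfl fun z hz => hinv z (Finset.ne_of_mem_erase hz), Finset.sum_const,
        Finset.card_erase_of_mem (Finset.mem_univ _), nsmul_eq_mul, Finset.card_univ,
        Nat.cast_sub Fintype.card_pos, Nat.cast_one]
    rw [h1, ← Finset.sum_fiberwise_of_maps_to (t := Finset.univ.erase (0 : F))
      (g := fun z => c * z ^ k) (fun z hz => by simpa [hc, hk.ne'] using hz), Finset.mul_sum]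
    refine Finset.sum_le_sum fun u _ => ?_
    rw [Finset.sum_congr rfl fun z hz => by rw [(Finset.mem_filter.mp hz).2], Finset.sum_const,
      nsmul_eq_mul]
    have hwu : 0 ≤ w u := by positivity
    gcongr
    refine le_trans (Finset.card_le_card ?_) (card_pow_eq_le_s12 hk (c⁻¹ * u))
    intro z hz
    have := (Finset.mem_filter.mp hz).2
    simp [← this, hc]
  have hup : ∑ u ∈ Finset.univ.erase (0 : F), w u ≤ q * (q - 1) * (k - 1) := by
    rw [← Finset.add_sum_erase _ _ (Finset.mem_univ (0 : F)), hw0] at hpars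
    nlinarith
  have : (q - 1) * w c ≤ (q - 1) * (k * (q * (k - 1))) := by nlinarith
  have := le_of_mul_le_mul_left this (by linarith)
  nlinarith

section

open Finset
open scoped Matrix

/-- The variance of the number of representations of a vector by a diagonal system whose columns
are in general position. -/
theorem sum_sq_card_diagonal_sub_le {F J M : Type*} [Field F] [Fintype F] [DecidableEq F]
    [Fintype J] [DecidableEq J] [Fintype M] [DecidableEq M] (A : Matrix J M F) (d : M → ℕ)
    (hd : ∀ l, 0 < d l) (D : ℕ) (hD : ∀ l, d l ≤ D) (hD1 : 1 ≤ D)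
    (hA : ∀ K : Finset M, #{u : J → F | u ≠ 0 ∧ ∀ l ∈ K, (u ᵥ* A) l = 0} * Fintype.card F ^ #K
      ≤ Fintype.card F ^ Fintype.card J) :
    ∑ v : J → F, ((#{z : M → F | (fun j => ∑ l, A j l * z l ^ d l) = v} : ℝ)
        - (Fintype.card F : ℝ) ^ Fintype.card M / (Fintype.card F : ℝ) ^ Fintype.card J) ^ 2
      ≤ (2 * (D : ℝ) ^ 2 * Fintype.card F) ^ Fintype.card M := by
  set q : ℝ := (Fintype.card F : ℝ) with hq
  have hq1 : 1 < q := by rw [hq]; exact_mod_cast Fintype.one_lt_card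
  have hD1' : (1 : ℝ) ≤ D := by exact_mod_cast hD1
  set ψ := AddChar.FiniteField.primitiveChar_to_Complex F
  have hψ : ψ.IsPrimitive := AddChar.FiniteField.primitiveChar_to_Complex_isPrimitive F
  set H : (M → F) → J → F := fun z j => ∑ l, A j l * z l ^ d l with hH
  have hprod : ∀ u : J → F, ∑ z, ψ (u ⬝ᵥ H z) = ∏ l, ∑ x, ψ ((u ᵥ* A) l * x ^ d l) := by
    intro u
    rw [Finset.prod_univ_sum, Fintype.piFinset_univ]
    refine sum_congr rfl fun z _ => ?_
    rw [← AddChar.map_finsetSum_eq_prod]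
    congr 1
    simp only [dotProduct, hH, Matrix.vecMul, mul_sum, sum_mul]
    rw [sum_comm]
    exact sum_congr rfl fun l _ => sum_congr rfl fun j _ => by ring
  have hW : ∀ u : J → F, ‖∑ z, ψ (u ⬝ᵥ H z)‖ ^ 2
      ≤ ∑ K : Finset M, if ∀ l ∈ K, (u ᵥ* A) l = 0
        then (D : ℝ) ^ (2 * Fintype.card M) * q ^ (Fintype.card M + #K) else 0 := by
    intro u
    rw [hprod, norm_prod, ← prod_pow]
    calc ∏ l, ‖∑ x, ψ ((u ᵥ* A) l * x ^ d l)‖ ^ 2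
        ≤ ∏ l, ((if (u ᵥ* A) l = 0 then q ^ 2 else 0) + (D : ℝ) ^ 2 * q) := by
          refine prod_le_prod (fun _ _ => by positivity) fun l _ => ?_
          split_ifs with h
          · simp only [h, zero_mul, AddChar.map_zero_eq_one, sum_const, card_univ, nsmul_eq_mul,
              mul_one, Complex.norm_natCast]
            have : 0 ≤ (D : ℝ) ^ 2 * q := by positivity
            linarith
          · rw [zero_add]
            refine (normSq_sum_addChar_mul_pow_le hψ (hd l) h).trans ?_
            gcongr
            exact hD l
      _ = ∑ K : Finset M, (∏ l ∈ K, if (u ᵥ* A) l = 0 then q ^ 2 else 0)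
            * ∏ l ∈ univ \ K, ((D : ℝ) ^ 2 * q) := by
          rw [prod_add, powerset_univ]
      _ ≤ _ := by
          refine sum_le_sum fun K _ => ?_
          split_ifs with h
          · rw [prod_congr rfl fun l hl => if_pos (h l hl), prod_const, prod_const]
            have hK : #(univ \ K) + #K = Fintype.card M := by
              rw [card_sdiff_add_card_eq_card (subset_univ K), card_univ]
            calc (q ^ 2) ^ #K * ((D : ℝ) ^ 2 * q) ^ #(univ \ K)
                = (D : ℝ) ^ (2 * #(univ \ K)) * q ^ (Fintype.card M + #K) := by
                  rw [← hK]; ring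
              _ ≤ _ := by
                  gcongr
                  exact card_le_univ _
          · push Not at h
            obtain ⟨l, hl, h⟩ := h
            rw [prod_eq_zero hl (if_neg h), zero_mul]
  have hbound : ∑ u ∈ univ.erase (0 : J → F), ‖∑ z, ψ (u ⬝ᵥ H z)‖ ^ 2
      ≤ q ^ Fintype.card J * (2 * (D : ℝ) ^ 2 * q) ^ Fintype.card M := by
    refine (sum_le_sum fun u _ => hW u).trans ?_
    rw [sum_comm]
    have hK : ∀ K : Finset M, (∑ u ∈ univ.erase (0 : J → F), if ∀ l ∈ K, (u ᵥ* A) l = 0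
        then (D : ℝ) ^ (2 * Fintype.card M) * q ^ (Fintype.card M + #K) else 0)
        ≤ (D : ℝ) ^ (2 * Fintype.card M) * q ^ (Fintype.card M) * q ^ Fintype.card J := by
      intro K
      have h := hA K
      have h' : (#{u : J → F | u ≠ 0 ∧ ∀ l ∈ K, (u ᵥ* A) l = 0} : ℝ) * q ^ #K
          ≤ q ^ Fintype.card J := by rw [hq]; exact_mod_cast h
      have hset : ((univ.erase (0 : J → F)).filter fun u => ∀ l ∈ K, (u ᵥ* A) l = 0)
          = univ.filter fun u : J → F => u ≠ 0 ∧ ∀ l ∈ K, (u ᵥ* A) l = 0 := by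
        ext u; simp
      rw [← sum_filter, sum_const, hset, nsmul_eq_mul, pow_add]
      calc _ = (D : ℝ) ^ (2 * Fintype.card M) * q ^ (Fintype.card M)
            * ((#{u : J → F | u ≠ 0 ∧ ∀ l ∈ K, (u ᵥ* A) l = 0} : ℝ) * q ^ #K) := by ring
        _ ≤ _ := by gcongr
    refine (sum_le_sum fun K _ => hK K).trans (le_of_eq ?_)
    rw [sum_const, card_univ, Fintype.card_finset, nsmul_eq_mul]
    push_cast
    ring
  have hpars := sum_normSq_sum_addChar hψ H
  have hW0 : ‖∑ z, ψ ((0 : J → F) ⬝ᵥ H z)‖ ^ 2 = q ^ (2 * Fintype.card M) := by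
    simp [hq]; ring
  have hcount : ∑ v : J → F, (#{z | H z = v} : ℝ) = q ^ Fintype.card M := by
    have : ∑ v : J → F, #{z | H z = v} = Fintype.card (M → F) := by
      rw [← card_univ, card_eq_sum_card_fiberwise (f := H) (t := univ) (fun x _ => by simp)]
    rw [hq]
    have h2 := congrArg (Nat.cast (R := ℝ)) this
    simpa using h2
  rw [← add_sum_erase _ _ (mem_univ (0 : J → F)), hW0] at hpars
  have hqJ : 0 < q ^ Fintype.card J := by positivity
  have hvar : ∑ v : J → F, ((#{z | H z = v} : ℝ) - q ^ Fintype.card M / q ^ Fintype.card J) ^ 2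
      = ∑ v : J → F, (#{z | H z = v} : ℝ) ^ 2 - q ^ (2 * Fintype.card M) / q ^ Fintype.card J := by
    simp only [sub_sq, sum_add_distrib, sum_sub_distrib, ← sum_mul, ← mul_sum, hcount]
    simp only [sum_const, card_univ, Fintype.card_fun, nsmul_eq_mul]
    push_cast
    rw [← hq]
    field_simp
    ring
  rw [hvar]
  refine le_of_mul_le_mul_left ?_ hqJ
  rw [mul_sub, ← hpars, mul_div_cancel₀ _ hqJ.ne']
  linarith

/-- If `G` has small fibres and the fibre sizes of `H` are close to constant, then the graph
`G y + H z = w` has about the expected number of points. -/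
theorem sq_card_add_eq_sub_le {Y Z V : Type*} [Fintype Y] [Fintype Z] [Fintype V] [DecidableEq V]
    [AddCommGroup V] (G : Y → V) (H : Z → V) (w : V) (B : ℕ)
    (hG : ∀ v, #{y | G y = v} ≤ B) (μ : ℝ) :
    ((#{p : Y × Z | G p.1 + H p.2 = w} : ℝ) - Fintype.card Y * μ) ^ 2
      ≤ Fintype.card Y * (B * ∑ v, ((#{z | H z = v} : ℝ) - μ) ^ 2) := by
  have hcard : (#{p : Y × Z | G p.1 + H p.2 = w} : ℝ) = ∑ y, (#{z | H z = w - G y} : ℝ) := by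
    simp only [card_filter]
    rw [← univ_product_univ, sum_product]
    push_cast
    refine sum_congr rfl fun y _ => sum_congr rfl fun z _ => ?_
    simp only [eq_sub_iff_add_eq']
  have hsub : (#{p : Y × Z | G p.1 + H p.2 = w} : ℝ) - Fintype.card Y * μ
      = ∑ y, ((#{z | H z = w - G y} : ℝ) - μ) := by
    rw [hcard, sum_sub_distrib, sum_const, card_univ, nsmul_eq_mul]
  rw [hsub]
  refine sq_sum_le_card_mul_sum_sq.trans ?_
  rw [card_univ]
  gcongr
  rw [← sum_fiberwise (g := fun y => w - G y), mul_sum]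
  refine sum_le_sum fun v _ => ?_
  rw [sum_congr rfl fun y hy => by rw [(mem_filter.mp hy).2], sum_const, nsmul_eq_mul]
  gcongr
  refine le_trans (card_le_card ?_) (hG (w - v))
  intro y hy
  have := (mem_filter.mp hy).2
  simp [← this]

theorem card_add_eq_le {Y Z V : Type*} [Fintype Y] [Fintype Z] [DecidableEq V]
    [AddCommGroup V] (G : Y → V) (H : Z → V) (w : V) (B : ℕ) (hG : ∀ v, #{y | G y = v} ≤ B) :
    #{p : Y × Z | G p.1 + H p.2 = w} ≤ B * Fintype.card Z := by
  have hcard : #{p : Y × Z | G p.1 + H p.2 = w} = ∑ z, #{y | G y = w - H z} := by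
    simp only [card_filter]
    rw [← univ_product_univ, sum_product_right]
    refine sum_congr rfl fun y _ => sum_congr rfl fun z _ => ?_
    simp only [eq_sub_iff_add_eq]
  rw [hcard]
  refine (sum_le_sum fun z _ => hG _).trans ?_
  rw [sum_const, card_univ, smul_eq_mul, mul_comm]

/-- Columns in general position: few nonzero row combinations vanish on a prescribed set `K` of
columns. -/
theorem card_vecMul_eq_zero_mul_le {F L : Type*} [Field F] [Fintype F] [DecidableEq F]
    [Fintype L] [DecidableEq L]
    {n : ℕ} (hn : n ≤ Fintype.card L) (A : Matrix (Fin n) L F)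
    (hH : ∀ φ : Fin n ↪ L, (A.submatrix id φ).det ≠ 0) (K : Finset L) :
    #{u : Fin n → F | u ≠ 0 ∧ ∀ l ∈ K, (u ᵥ* A) l = 0} * Fintype.card F ^ #K
      ≤ Fintype.card F ^ n := by
  have key : ∀ (K : Finset L) (u : Fin n → F), n ≤ #K → (∀ l ∈ K, (u ᵥ* A) l = 0) → u = 0 := by
    intro K u hK hu
    obtain ⟨K', hK', hcard⟩ := exists_subset_card_eq hK
    let φ : Fin n ↪ L := (K'.equivFinOfCardEq hcard).symm.toEmbedding.trans
      (Function.Embedding.subtype _)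
    refine Matrix.eq_zero_of_vecMul_eq_zero (hH φ) ?_
    ext i
    exact hu _ (hK' ((K'.equivFinOfCardEq hcard).symm i).2)
  rcases le_total n #K with h | h
  · have : ({u : Fin n → F | u ≠ 0 ∧ ∀ l ∈ K, (u ᵥ* A) l = 0} : Finset (Fin n → F)) = ∅ := by
      rw [filter_eq_empty_iff]
      rintro u - ⟨h0, hu⟩
      exact h0 (key K u h hu)
    rw [this]
    simp
  · obtain ⟨K', hK', -, hcard⟩ := exists_subsuperset_card_eq (subset_univ K) h
      (by rwa [card_univ])
    have hle : #{u : Fin n → F | u ≠ 0 ∧ ∀ l ∈ K, (u ᵥ* A) l = 0}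
        ≤ #(univ : Finset (↥(K' \ K) → F)) := by
      refine card_le_card_of_injOn (fun u l => (u ᵥ* A) l) (fun _ _ => by simp) ?_
      intro u hu v hv huv
      simp only [coe_filter, mem_univ, true_and, Set.mem_ofPred_eq] at hu hv
      rw [← sub_eq_zero]
      refine key K' _ hcard.ge fun l hl => ?_
      rw [Matrix.sub_vecMul, Pi.sub_apply, sub_eq_zero]
      by_cases hlK : l ∈ K
      · rw [hu.2 l hlK, hv.2 l hlK]
      · exact congrFun huv ⟨l, mem_sdiff.mpr ⟨hl, hlK⟩⟩
    rw [card_univ, Fintype.card_fun, Fintype.card_coe, card_sdiff_of_subset hK', hcard] at hle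
    calc _ ≤ Fintype.card F ^ (n - #K) * Fintype.card F ^ #K := by gcongr
      _ = _ := by rw [← pow_add, Nat.sub_add_cancel h]

/-- A square system with invertible leading part and lower-degree perturbation has fibres of
bounded size. -/
theorem card_fiber_diagonal_sub_monomial_le {F σ : Type*} [Field F] [Fintype F] [DecidableEq F]
    [Fintype σ] [DecidableEq σ] (A : Matrix σ σ F) (hA : A.det ≠ 0) (d : σ → ℕ)
    (b : σ → F) (c : σ → σ → ℕ) (hc : ∀ j l, ∑ i, c j i < d l) (v : σ → F) :
    #{y : σ → F | (fun j => ∑ l, A j l * y l ^ d l - b j * ∏ l, y l ^ c j l) = v}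
      ≤ ∏ l, d l := by
  refine card_le_prod_of_pow_eq_lower _ d (fun l => (Nat.zero_le _).trans_lt (hc l l))
    (A⁻¹.mulVec v) (fun l j => A⁻¹ l j * b j) c hc ?_
  intro y hy l
  have h := (mem_filter.mp hy).2
  have h1 : A.mulVec (fun l => y l ^ d l) = v + fun j => b j * ∏ l, y l ^ c j l := by
    rw [← h]
    ext j
    simp [Matrix.mulVec, dotProduct]
  have h2 := congrArg A⁻¹.mulVec h1
  rw [Matrix.mulVec_mulVec, Matrix.nonsing_inv_mul _ (isUnit_iff_ne_zero.mpr hA),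
    Matrix.one_mulVec, Matrix.mulVec_add] at h2
  rw [congrFun h2 l, Pi.add_apply]
  congr 1
  simp [Matrix.mulVec, dotProduct, mul_assoc]

/-- Points vanishing on `S` are determined by their restrictions to the range of `φ` and to the
remaining coordinates. -/
theorem ncard_vanishing_eq_card_prod {F L P : Type*} [Zero F] [Fintype F]
    [Fintype L] [DecidableEq L] [Fintype P] [DecidableEq P] (S : Finset L) (φ : P ↪ L)
    (hφ : ∀ i, φ i ∉ S) (Q : (P → F) × (↥(Sᶜ \ univ.map φ) → F) → Prop) [DecidablePred Q] :
    Set.ncard {x : L → F | (∀ j ∈ S, x j = 0) ∧ Q (fun i => x (φ i), fun l => x l)}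
      = #{p | Q p} := by
  rw [← Set.ncard_coe_finset]
  refine Set.ncard_congr (fun x _ => (fun i => x (φ i), fun l => x l)) ?_ ?_ ?_
  · rintro x ⟨-, hx⟩
    simpa using hx
  · rintro x x' ⟨hx, -⟩ ⟨hx', -⟩ h
    obtain ⟨h1, h2⟩ := Prod.ext_iff.mp h
    ext l
    by_cases hl : l ∈ S
    · rw [hx l hl, hx' l hl]
    · by_cases hr : ∃ i, φ i = l
      · obtain ⟨i, rfl⟩ := hr
        exact congrFun h1 i
      · exact congrFun h2 ⟨l, by simpa [hl] using hr⟩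
  · rintro ⟨y, z⟩ hyz
    have hQ : Q (y, z) := by simpa using hyz
    let x : L → F := Function.extend φ y
      fun l => if h : l ∈ Sᶜ \ univ.map φ then z ⟨l, h⟩ else 0
    have hy : (fun i => x (φ i)) = y := by
      ext i
      exact φ.injective.extend_apply _ _ _
    have hz : (fun l : ↥(Sᶜ \ univ.map φ) => x l) = z := by
      ext l
      have hl : ¬ ∃ i, φ i = l.1 := by simpa using (mem_sdiff.mp l.2).2
      simp only [x]
      rw [Function.extend_apply' _ _ _ hl, dif_pos l.2]
    have hS : ∀ j ∈ S, x j = 0 := by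
      intro j hj
      have hl : ¬ ∃ i, φ i = j := by
        rintro ⟨i, rfl⟩
        exact hφ i hj
      simp only [x]
      rw [Function.extend_apply' _ _ _ hl, dif_neg (by simp [hj])]
    exact ⟨x, ⟨hS, by rw [hy, hz]; exact hQ⟩, Prod.ext hy hz⟩

theorem sum_eq_sum_embedding_add_sum {F L P : Type*} [AddCommMonoid F]
    [Fintype L] [DecidableEq L] [Fintype P] (S : Finset L) (φ : P ↪ L)
    (hφ : ∀ i, φ i ∉ S) (f : L → F) (hf : ∀ l ∈ S, f l = 0) :
    ∑ l, f l = ∑ i, f (φ i) + ∑ l : ↥(Sᶜ \ univ.map φ), f l := by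
  have hsub : univ.map φ ⊆ Sᶜ := by
    intro l hl
    obtain ⟨i, -, rfl⟩ := mem_map.mp hl
    exact mem_compl.mpr (hφ i)
  rw [sum_coe_sort (Sᶜ \ univ.map φ) f, ← sum_map univ φ f, add_comm, sum_sdiff hsub]
  exact (sum_subset (subset_univ _) fun l _ hl => hf l (by simpa using hl)).symm

/-- On points vanishing on `S`, monomials in the first `n` coordinates can be rewritten, up to a
scalar, in `n` coordinates chosen compatibly with `S`. -/
theorem exists_embedding_monomial_eq {F : Type*} [Field F] {n t : ℕ} (hnt : n ≤ t)
    (c : Fin n → Fin n → ℕ) (hc : ∀ j l, 0 < c j l) (S : Finset (Fin t)) :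
    ∃ (φ : Fin n ↪ Fin t) (ε : F),
      (∀ x : Fin t → F, (∀ j ∈ S, x j = 0) → ∀ j,
        ∏ l, x (Fin.castLE hnt l) ^ c j l = ε * ∏ l, x (φ l) ^ c j l) ∧
      (n ≤ #Sᶜ → ∀ i, φ i ∉ S) ∧ (#Sᶜ < n → ∀ l ∉ S, ∃ i, φ i = l) := by
  by_cases h : ∀ l : Fin n, Fin.castLE hnt l ∉ S
  · refine ⟨Fin.castLEEmb hnt, 1, fun x _ j => by simp, fun _ => h, fun hlt => ?_⟩
    have : #(univ.map (Fin.castLEEmb hnt)) ≤ #Sᶜ := by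
      refine card_le_card fun l hl => ?_
      obtain ⟨i, -, rfl⟩ := mem_map.mp hl
      exact mem_compl.mpr (h i)
    simp at this
    omega
  · push Not at h
    obtain ⟨l₀, hl₀⟩ := h
    have hprod : ∀ x : Fin t → F, (∀ j ∈ S, x j = 0) → ∀ j,
        ∏ l, x (Fin.castLE hnt l) ^ c j l = 0 := by
      intro x hx j
      refine prod_eq_zero (mem_univ l₀) ?_
      rw [hx _ hl₀, zero_pow (hc j l₀).ne']
    have key : ∃ P : Finset (Fin t), #P = n ∧ (n ≤ #Sᶜ → P ⊆ Sᶜ) ∧ (#Sᶜ < n → Sᶜ ⊆ P) := by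
      rcases le_or_gt n #Sᶜ with hle | hlt
      · obtain ⟨P, hP, hcard⟩ := exists_subset_card_eq hle
        exact ⟨P, hcard, fun _ => hP, fun h => by omega⟩
      · obtain ⟨P, hP, -, hcard⟩ := exists_subsuperset_card_eq (subset_univ Sᶜ) hlt.le (by simpa)
        exact ⟨P, hcard, fun h => by omega, fun _ => hP⟩
    obtain ⟨P, hcard, h1, h2⟩ := key
    refine ⟨(P.equivFinOfCardEq hcard).symm.toEmbedding.trans (Function.Embedding.subtype _), 0,
      fun x hx j => by rw [hprod x hx j, zero_mul], fun hle i => ?_, fun hlt l hl => ?_⟩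
    · exact mem_compl.mp (h1 hle ((P.equivFinOfCardEq hcard).symm i).2)
    · exact ⟨P.equivFinOfCardEq hcard ⟨l, h2 hlt (mem_compl.mpr hl)⟩, by simp⟩

end


/-- estimates for the number N_S of solutions of a system of
generalized Markoff–Hurwitz-type equations whose coordinates indexed by S
vanish, according to the size i = |S|. -/
theorem markoff_hurwitz_system_vanishing_coordinates_estimate
    (q t n : ℕ) (hq : IsPrimePow q)
    (F : Type*) [Field F] [Fintype F] (hFq : Fintype.card F = q)
    (ht : 0 < t) (hn : 0 < n) (hnt : 2 * n + 2 ≤ t) (hnt' : n ≤ t)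
    (d : Fin t → ℕ) (hd : StrictAnti d) (hd2 : ∀ i, 2 ≤ d i)
    (hchar : ∀ i, ¬ (ringChar F ∣ d i))
    (A : Matrix (Fin n) (Fin t) F)
    (hH : ∀ φ : Fin n ↪ Fin t, (A.submatrix id φ).det ≠ 0)
    (c : Fin n → Fin n → ℕ) (hc : ∀ j l, 0 < c j l)
    (hcd : ∀ j, ∑ l, c j l < d ⟨t - 1, Nat.sub_lt ht Nat.one_pos⟩)
    (a : Fin n → F) (ha : ∃ j, a j ≠ 0)
    (b : Fin n → F) (hb : ∀ j, b j ≠ 0)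
    (S : Finset (Fin t))
    (NS : ℕ)
    (hNS : NS = Set.ncard {x : Fin t → F |
      (∀ j ∈ S, x j = 0) ∧
      ∀ j, ∑ l, A j l * x l ^ d l + a j
        = b j * ∏ l : Fin n, x (Fin.castLE hnt' l) ^ c j l}) :
    ((1 ≤ S.card ∧ S.card ≤ t - 2 * n - 1) →
        |(NS : ℝ) - (q : ℝ) ^ (t - S.card - n)|
          ≤ (q : ℝ) ^ (((t : ℝ) - S.card) / 2)
            * ((6 * n * d ⟨0, ht⟩ : ℕ) : ℝ) ^ (t - S.card + 1))
    ∧ ((t - 2 * n ≤ S.card ∧ S.card ≤ t - n) →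
        (NS : ℝ) ≤ ((d ⟨0, ht⟩ : ℕ) : ℝ) ^ n * (q : ℝ) ^ (t - n - S.card))
    ∧ ((t - n + 1 ≤ S.card) →
        (NS : ℝ) ≤ ((d ⟨0, ht⟩ : ℕ) : ℝ) ^ n) := by
  classical
  subst hFq
  set D := d ⟨0, ht⟩ with hDdef
  have hdD : ∀ l, d l ≤ D := fun l => hd.antitone (Fin.mk_le_of_le_val (Nat.zero_le _))
  have hD1 : 1 ≤ D := by have := hd2 ⟨0, ht⟩; omega
  have hcd' : ∀ j l, ∑ i, c j i < d l := fun j l =>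
    (hcd j).trans_le (hd.antitone (Fin.le_def.mpr (by have := l.2; simp only; omega)))
  have hSt : S.card ≤ t := by simpa using Finset.card_le_univ S
  have hSc : Sᶜ.card = t - S.card := by rw [Finset.card_compl, Fintype.card_fin]
  obtain ⟨φ, ε, hmon, hφ, hφ'⟩ := exists_embedding_monomial_eq (F := F) hnt' c hc S
  set G : (Fin n → F) → Fin n → F := fun y j =>
    ∑ i, A j (φ i) * y i ^ d (φ i) - b j * ε * ∏ i, y i ^ c j i with hG
  have hfib : ∀ v, (Finset.univ.filter fun y => G y = v).card ≤ D ^ n := by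
    intro v
    refine (card_fiber_diagonal_sub_monomial_le (A.submatrix id φ) (hH φ) (fun i => d (φ i))
      (fun j => b j * ε) c (fun j l => hcd' j _) v).trans ?_
    refine (Finset.prod_le_prod' fun i _ => hdD (φ i)).trans ?_
    simp
  have hd0 : ∀ l, d l ≠ 0 := fun l => by have := hd2 l; omega
  have hlarge : n ≤ Sᶜ.card → NS = (Finset.univ.filter
      fun p : (Fin n → F) × (↥(Sᶜ \ Finset.univ.map φ) → F) =>
        G p.1 + (fun j => ∑ l : ↥(Sᶜ \ Finset.univ.map φ), A j l * p.2 l ^ d l) = -a).card := by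
    intro hle
    rw [hNS, ← ncard_vanishing_eq_card_prod S φ (hφ hle)]
    congr 1
    ext x
    refine and_congr_right fun hx => ?_
    rw [funext_iff]
    refine forall_congr' fun j => ?_
    rw [hmon x hx j, sum_eq_sum_embedding_add_sum S φ (hφ hle) (fun l => A j l * x l ^ d l)
      fun l hl => by rw [hx l hl, zero_pow (hd0 l), mul_zero]]
    simp only [hG, Pi.add_apply, Pi.neg_apply]
    constructor <;> intro h <;> linear_combination h
  have hMcard : n ≤ Sᶜ.card → Fintype.card ↥(Sᶜ \ Finset.univ.map φ) = t - S.card - n := by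
    intro hle
    rw [Fintype.card_coe, Finset.card_sdiff_of_subset, hSc, Finset.card_map, Finset.card_univ,
      Fintype.card_fin]
    intro l hl
    obtain ⟨i, -, rfl⟩ := Finset.mem_map.mp hl
    exact Finset.mem_compl.mpr (hφ hle i)
  refine ⟨?_, ?_, ?_⟩
  · rintro ⟨-, hS⟩
    have hle : n ≤ Sᶜ.card := by omega
    have hM := hMcard hle
    have h1 := sum_sq_card_diagonal_sub_le
      (A.submatrix id (Subtype.val : ↥(Sᶜ \ Finset.univ.map φ) → Fin t)) (fun l => d l)
      (fun l => Nat.pos_of_ne_zero (hd0 l)) D (fun l => hdD l) hD1 (fun K => by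
        rw [Fintype.card_fin]
        refine card_vecMul_eq_zero_mul_le (by omega) _ (fun ψ => ?_) K
        rw [Matrix.submatrix_submatrix]
        exact hH (ψ.trans (Function.Embedding.subtype _)))
    have h2 := sq_card_add_eq_sub_le G
      (fun (z : ↥(Sᶜ \ Finset.univ.map φ) → F) j =>
        ∑ l : ↥(Sᶜ \ Finset.univ.map φ), A j l * z l ^ d l) (-a) (D ^ n) hfib
      ((Fintype.card F : ℝ) ^ (t - S.card - n) / (Fintype.card F : ℝ) ^ n)
    rw [← hlarge hle] at h2
    rw [hM, Fintype.card_fin] at h1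
    have hq0 : (0 : ℝ) < Fintype.card F := by exact_mod_cast Fintype.card_pos
    set q : ℝ := (Fintype.card F : ℝ) with hqdef
    have hYcard : ((Fintype.card (Fin n → F) : ℕ) : ℝ) = q ^ n := by simp [hqdef]
    rw [hYcard, mul_div_cancel₀ _ (by positivity)] at h2
    set E : ℝ := ((6 * n * D : ℕ) : ℝ) with hE
    have hn1 : (1 : ℝ) ≤ n := by exact_mod_cast hn
    have hD1' : (1 : ℝ) ≤ D := by exact_mod_cast hD1
    have hDE : 6 * (D : ℝ) ≤ E := by
      rw [hE]
      push_cast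
      nlinarith
    have hDE' : 2 * (D : ℝ) ^ 2 ≤ E ^ 2 := by nlinarith
    have hE1 : 1 ≤ E := by linarith
    refine abs_le_of_sq_le_sq ?_ (by positivity)
    have hsq : (q ^ (((t : ℝ) - S.card) / 2)) ^ 2 = q ^ (t - S.card) := by
      rw [← Real.rpow_natCast, ← Real.rpow_mul hq0.le, ← Real.rpow_natCast, Nat.cast_sub hSt]
      congr 1
      push_cast
      ring
    rw [mul_pow, hsq]
    have h1' := mul_le_mul_of_nonneg_left h1 (by positivity : (0 : ℝ) ≤ q ^ n * ((D ^ n : ℕ) : ℝ))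
    calc _ ≤ _ := h2
      _ ≤ q ^ n * ((D ^ n : ℕ) : ℝ) * (2 * (D : ℝ) ^ 2 * q) ^ (t - S.card - n) := by
        rw [← mul_assoc]
        exact h1'
      _ = (q ^ n * q ^ (t - S.card - n))
          * ((D : ℝ) ^ n * (2 * (D : ℝ) ^ 2) ^ (t - S.card - n)) := by
        push_cast
        rw [mul_pow _ q]
        ring
      _ ≤ q ^ (t - S.card) * (E ^ n * (E ^ 2) ^ (t - S.card - n)) := by
        rw [← pow_add, show n + (t - S.card - n) = t - S.card by omega]
        gcongr
        linarith
      _ ≤ q ^ (t - S.card) * (E ^ (t - S.card + 1)) ^ 2 := by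
        rw [← pow_mul, ← pow_add, ← pow_mul]
        gcongr
        omega
  · rintro ⟨-, hS⟩
    have hle : n ≤ Sᶜ.card := by omega
    have h := card_add_eq_le G
      (fun (z : ↥(Sᶜ \ Finset.univ.map φ) → F) j =>
        ∑ l : ↥(Sᶜ \ Finset.univ.map φ), A j l * z l ^ d l) (-a) (D ^ n) hfib
    rw [← hlarge hle, Fintype.card_fun, hMcard hle, Nat.sub_right_comm] at h
    exact_mod_cast h
  · intro hS
    have hlt : Sᶜ.card < n := by omega
    have h : NS ≤ (Finset.univ.filter fun y => G y = -a).card := by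
      rw [hNS, ← Set.ncard_coe_finset]
      refine Set.ncard_le_ncard_of_injOn (fun x i => x (φ i)) ?_ ?_ (Finset.finite_toSet _)
      · rintro x ⟨hx, hxe⟩
        rw [Finset.mem_coe, Finset.mem_filter]
        refine ⟨Finset.mem_univ _, funext fun j => ?_⟩
        have hj := hxe j
        rw [hmon x hx j] at hj
        have hsum : ∑ l, A j l * x l ^ d l = ∑ i, A j (φ i) * x (φ i) ^ d (φ i) := by
          rw [← Finset.sum_map Finset.univ φ fun l => A j l * x l ^ d l]
          refine (Finset.sum_subset (Finset.subset_univ _) fun l _ hl => ?_).symm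
          have hlS : l ∈ S := by
            by_contra hlS
            exact hl (by simpa using hφ' hlt l hlS)
          rw [hx l hlS, zero_pow (hd0 l), mul_zero]
        rw [hsum] at hj
        simp only [hG, Pi.neg_apply]
        linear_combination hj
      · rintro x ⟨hx, -⟩ x' ⟨hx', -⟩ h
        ext l
        by_cases hl : l ∈ S
        · rw [hx l hl, hx' l hl]
        · obtain ⟨i, rfl⟩ := hφ' hlt l hl
          exact congrFun h i
    exact_mod_cast h.trans (hfib _)
end
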